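/- arXiv:1502.05920 — 2 statements merged into one kernel-verified Lean document; each statement's English description precedes it below -/
import Mathlib

section
/- Under the standing assumptions (Θ nonempty convex with K < ∞, C closed convex containing 0, C∩C^0 compact, h continuous), assume in addition that Θ is sequentially compact in the following sense: every sequence (b_k,c_k,F_k) in Θ has a subsequence along which b_k → b in ℝ^d, c_k → c in the matrices, and |z|²∧1·F_k → |z|²∧1·F weakly (tested against bounded continuous functions), for some (b,c,F) ∈ Θ. Then the function (θ,y) ↦ g^θ(y) admits a saddle point on Θ × (C∩C^0): there exist θ̂ ∈ Θ and ŷ ∈ C∩C^0 such that g^{θ̂}(y) ≤ g^{θ̂}(ŷ) ≤ g^θ(ŷ) for all y ∈ C∩C^0 and all θ ∈ Θ. -/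
open MeasureTheory Filter Set
open scoped ENNReal NNReal Topology

noncomputable section

/-- The positive part of an extended real number, as an element of `ℝ≥0∞`. -/
def EReal.posPart (x : EReal) : ℝ≥0∞ := if x = ⊤ then ⊤ else ENNReal.ofReal x.toReal

/-- Integral of an `EReal`-valued function, defined as the difference of the lintegrals of
the positive and negative parts, with the conventions of `EReal` arithmetic
(in particular `∞ - ∞ = -∞`). -/
def eIntegral {α : Type*} [MeasurableSpace α] (F : Measure α) (f : α → EReal) : EReal :=
  ((∫⁻ z, (f z).posPart ∂F : ℝ≥0∞) : EReal) - ((∫⁻ z, (-(f z)).posPart ∂F : ℝ≥0∞) : EReal)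

/-- The dot product `y^⊤ z` on `ℝ^d`. -/
def dotp {d : ℕ} (y z : EuclideanSpace ℝ (Fin d)) : ℝ := ∑ i, y i * z i

/-- The quadratic form `y^⊤ c y`. -/
def quadf {d : ℕ} (c : Matrix (Fin d) (Fin d) ℝ) (y : EuclideanSpace ℝ (Fin d)) : ℝ :=
  ∑ i, ∑ j, c i j * y i * y j

/-- The (Frobenius) norm `|c|` of a matrix. -/
def matNorm {d : ℕ} (c : Matrix (Fin d) (Fin d) ℝ) : ℝ :=
  Real.sqrt (∑ i, ∑ j, (c i j) ^ 2)

/-- A Lévy measure on `ℝ^d`: a (Borel) measure with `F({0}) = 0` and `∫ |z|² ∧ 1 F(dz) < ∞`. -/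
def IsLevyMeasure {d : ℕ} (F : Measure (EuclideanSpace ℝ (Fin d))) : Prop :=
  F {0} = 0 ∧ ∫⁻ z, ENNReal.ofReal (min (‖z‖ ^ 2) 1) ∂F < ⊤

/-- A truncation function: bounded, measurable, equal to the identity near the origin. -/
structure IsTruncation {d : ℕ}
    (h : EuclideanSpace ℝ (Fin d) → EuclideanSpace ℝ (Fin d)) : Prop where
  measurable : Measurable h
  bounded : ∃ M : ℝ, ∀ z, ‖h z‖ ≤ M
  eq_id_near_zero : ∃ δ : ℝ, 0 < δ ∧ ∀ z, ‖z‖ < δ → h z = z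

/-- The integrand `I_y(z)`, as an extended real number:
`log(1+y^⊤z) - y^⊤h(z)` if `p = 0`, and `p⁻¹(1+y^⊤z)^p - p⁻¹ - y^⊤h(z)` if `p ≠ 0`,
with the conventions `log 0 = -∞` and `0^p = +∞` for `p < 0` (so that the integrand
is `-∞` on `{1 + y^⊤z ≤ 0}` when `p ≤ 0`). -/
def Ifun {d : ℕ} (p : ℝ) (h : EuclideanSpace ℝ (Fin d) → EuclideanSpace ℝ (Fin d))
    (y z : EuclideanSpace ℝ (Fin d)) : EReal :=
  if 0 < 1 + dotp y z then
    (if p = 0 then ((Real.log (1 + dotp y z) - dotp y (h z) : ℝ) : EReal)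
      else ((p⁻¹ * (1 + dotp y z) ^ p - p⁻¹ - dotp y (h z) : ℝ) : EReal))
  else if p ≤ 0 then (⊥ : EReal)
  else ((p⁻¹ * (1 + dotp y z) ^ p - p⁻¹ - dotp y (h z) : ℝ) : EReal)

/-- The function `g^{(b,c,F)}(y) = y^⊤b + ((p-1)/2)·y^⊤cy + ∫ I_y(z) F(dz)`. -/
def gfun {d : ℕ} (p : ℝ) (h : EuclideanSpace ℝ (Fin d) → EuclideanSpace ℝ (Fin d))
    (b : EuclideanSpace ℝ (Fin d)) (c : Matrix (Fin d) (Fin d) ℝ)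
    (F : Measure (EuclideanSpace ℝ (Fin d))) (y : EuclideanSpace ℝ (Fin d)) : EReal :=
  ((dotp y b + (p - 1) / 2 * quadf c y : ℝ) : EReal) + eIntegral F (fun z => Ifun p h y z)

/-- Triples `θ = (b, c, F)`. -/
abbrev Triple (d : ℕ) :=
  EuclideanSpace ℝ (Fin d) × Matrix (Fin d) (Fin d) ℝ × Measure (EuclideanSpace ℝ (Fin d))

/-- `g^θ(y)` for a triple `θ = (b,c,F)`. -/
def gTheta {d : ℕ} (p : ℝ) (h : EuclideanSpace ℝ (Fin d) → EuclideanSpace ℝ (Fin d))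
    (θ : Triple d) (y : EuclideanSpace ℝ (Fin d)) : EReal :=
  gfun p h θ.1 θ.2.1 θ.2.2 y

/-- The integrand appearing in the definition of the constant `K`, depending on `p`
(and an extra parameter `ε > 0` when `p ∈ (0,1)`). -/
def Kintegrand {d : ℕ} (p ε : ℝ) (z : EuclideanSpace ℝ (Fin d)) : ℝ :=
  if p = 0 then min (‖z‖ ^ 2) (Real.log (1 + ‖z‖))
  else if 0 < p then min (‖z‖ ^ 2) (‖z‖ ^ (p * (1 + ε)))
  else min (‖z‖ ^ 2) 1

/-- The natural constraints `C⁰ = ∩_{F ∈ L_Θ} {y : F({z : y^⊤z < -1}) = 0}`. -/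
def natC {d : ℕ} (Θ : Set (Triple d)) : Set (EuclideanSpace ℝ (Fin d)) :=
  {y | ∀ θ ∈ Θ, θ.2.2 {z | dotp y z < -1} = 0}

/-- The sets `C⁰ₙ = ∩_{F ∈ L_Θ} {y : F({z : y^⊤z < -1 + 1/n}) = 0}`. -/
def natCn {d : ℕ} (Θ : Set (Triple d)) (n : ℕ) : Set (EuclideanSpace ℝ (Fin d)) :=
  {y | ∀ θ ∈ Θ, θ.2.2 {z | dotp y z < -1 + 1 / (n : ℝ)} = 0}

/-- The finite measure `|z|² ∧ 1 · F`. -/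
def sq1Measure {d : ℕ} (F : Measure (EuclideanSpace ℝ (Fin d))) :
    Measure (EuclideanSpace ℝ (Fin d)) :=
  F.withDensity (fun z => ENNReal.ofReal (min (‖z‖ ^ 2) 1))

/-- The standing assumptions of the paper: `p = 0` or `p ∈ (-∞,0) ∪ (0,1)`, `ε > 0`,
`h` is a truncation function, `Θ` is a nonempty convex set of Lévy triplets with `K < ∞`,
`C` is closed, convex and contains `0`, and `C ∩ C⁰` is compact. -/
structure Standing {d : ℕ} (p ε : ℝ)
    (h : EuclideanSpace ℝ (Fin d) → EuclideanSpace ℝ (Fin d))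
    (Θ : Set (Triple d)) (C : Set (EuclideanSpace ℝ (Fin d))) : Prop where
  p_range : p = 0 ∨ p < 0 ∨ (0 < p ∧ p < 1)
  eps_pos : 0 < ε
  trunc : IsTruncation h
  Theta_nonempty : Θ.Nonempty
  Theta_psd : ∀ θ ∈ Θ, (θ.2.1).PosSemidef
  Theta_levy : ∀ θ ∈ Θ, IsLevyMeasure θ.2.2
  Theta_convex : ∀ θ₁ ∈ Θ, ∀ θ₂ ∈ Θ, ∀ t : ℝ, 0 ≤ t → t ≤ 1 →
    (t • θ₁.1 + (1 - t) • θ₂.1, t • θ₁.2.1 + (1 - t) • θ₂.2.1,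
      ENNReal.ofReal t • θ₁.2.2 + ENNReal.ofReal (1 - t) • θ₂.2.2) ∈ Θ
  K_finite : ∃ K : ℝ, ∀ θ ∈ Θ,
    (∫⁻ z, ENNReal.ofReal (Kintegrand p ε z) ∂θ.2.2) ≠ ⊤ ∧
    ‖θ.1‖ + matNorm θ.2.1 + (∫⁻ z, ENNReal.ofReal (Kintegrand p ε z) ∂θ.2.2).toReal ≤ K
  C_closed : IsClosed C
  C_convex : Convex ℝ C
  C_zero : (0 : EuclideanSpace ℝ (Fin d)) ∈ C
  CC0_compact : IsCompact (C ∩ natC Θ)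

/-- Half of the minimax theorem for finitely many points: if every `G θ` is at least `c` at one of
the points, then a convex combination of the points works for all `θ`. -/
theorem exists_forall_le_of_forall_exists_le {α E ι : Type*} [AddCommGroup E] [Module ℝ E]
    [Fintype ι] {Θ : Set α} (hΘ : Θ.Nonempty) {S : Set E} {G : α → E → ℝ} {z : ι → E}
    (hz : ∀ i, z i ∈ S) (hconc : ∀ θ ∈ Θ, ConcaveOn ℝ S (G θ))
    (hconv : ∀ θ₁ ∈ Θ, ∀ θ₂ ∈ Θ, ∀ t : ℝ, 0 ≤ t → t ≤ 1 → ∃ θ ∈ Θ, ∀ y ∈ S,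
      G θ y ≤ t * G θ₁ y + (1 - t) * G θ₂ y)
    {c : ℝ} (hc : ∀ θ ∈ Θ, ∃ i, c ≤ G θ (z i)) :
    ∃ y ∈ S, ∀ θ ∈ Θ, c ≤ G θ y := by
  classical
  obtain ⟨θ₀, hθ₀⟩ := hΘ
  let A : Set (ι → ℝ) := {x | ∃ θ ∈ Θ, ∀ i, G θ (z i) ≤ x i}
  let B : Set (ι → ℝ) := Set.pi univ fun _ => Iio c
  have hA : Convex ℝ A := by
    rintro x ⟨θ₁, h₁, hx⟩ y ⟨θ₂, h₂, hy⟩ a b ha hb hab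
    obtain ⟨θ, hθ, hle⟩ := hconv θ₁ h₁ θ₂ h₂ a ha (by linarith)
    refine ⟨θ, hθ, fun i => (hle _ (hz i)).trans ?_⟩
    have hb' : 1 - a = b := by linarith
    simp only [hb', Pi.add_apply, Pi.smul_apply, smul_eq_mul]
    gcongr
    exacts [hx i, hy i]
  have hB : Convex ℝ B := convex_pi fun _ _ => convex_Iio c
  have hBo : IsOpen B := isOpen_set_pi finite_univ fun _ _ => isOpen_Iio
  have hdisj : Disjoint B A := by
    rw [Set.disjoint_left]
    rintro x hx ⟨θ, hθ, hle⟩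
    obtain ⟨i, hi⟩ := hc θ hθ
    exact absurd (hi.trans (hle i)) (not_le.2 (hx i (mem_univ i)))
  obtain ⟨f, u, hfB, hfA⟩ := geometric_hahn_banach_open hB hBo hA hdisj
  have hf : ∀ x : ι → ℝ, f x = ∑ i, f (Pi.single i 1) * x i := by
    intro x
    conv_lhs => rw [← Finset.univ_sum_single x, map_sum]
    refine Finset.sum_congr rfl fun i _ => ?_
    rw [mul_comm, ← smul_eq_mul, ← map_smul, ← Pi.single_smul, smul_eq_mul, mul_one]
  set w : ι → ℝ := fun i => f (Pi.single i 1) with hw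
  have hw0 : ∀ i, 0 ≤ w i := by
    intro i
    by_contra! hneg
    let b : ι → ℝ := fun _ => c - 1
    obtain ⟨n, hn⟩ := exists_nat_gt ((u - f b) / (-w i))
    rw [div_lt_iff₀ (by linarith)] at hn
    have hmem : b - (n : ℝ) • Pi.single i 1 ∈ B := by
      intro j _
      have : (0 : ℝ) ≤ n * (Pi.single i 1 : ι → ℝ) j := by
        rw [Pi.single_apply]; split_ifs <;> simp
      simp only [Pi.sub_apply, Pi.smul_apply, smul_eq_mul, mem_Iio, b]
      linarith
    have := hfB _ hmem
    rw [map_sub, map_smul, smul_eq_mul] at this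
    simp only [hw] at hn
    linarith
  have hAθ : ∀ θ ∈ Θ, u ≤ ∑ i, w i * G θ (z i) := fun θ hθ => by
    rw [← hf]; exact hfA _ ⟨θ, hθ, fun i => le_rfl⟩
  have hBδ : ∀ δ > 0, (∑ i, w i) * (c - δ) < u := fun δ hδ => by
    have := hfB (fun _ => c - δ) (fun i _ => by simpa using hδ)
    rwa [hf, ← Finset.sum_mul] at this
  have hs : 0 < ∑ i, w i := by
    refine lt_of_le_of_ne (Finset.sum_nonneg fun i _ => hw0 i) fun h0 => ?_
    have hzero : ∀ i, w i = 0 := fun i =>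
      (Finset.sum_eq_zero_iff_of_nonneg fun i _ => hw0 i).1 h0.symm i (Finset.mem_univ i)
    have h1 := hBδ 1 one_pos
    have h2 := hAθ θ₀ hθ₀
    simp only [hzero, zero_mul, Finset.sum_const_zero] at h1 h2
    linarith
  set s := ∑ i, w i with hsdef
  have hcu : s * c ≤ u := by
    refine le_of_forall_pos_lt_add fun δ hδ => ?_
    have := hBδ (δ / s) (by positivity)
    rw [mul_sub, mul_div_cancel₀ _ hs.ne'] at this
    linarith
  have hsum : ∑ i, w i / s = 1 := by rw [← Finset.sum_div, div_self hs.ne']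
  refine ⟨∑ i, (w i / s) • z i, (hconc θ₀ hθ₀).1.sum_mem
    (fun i _ => div_nonneg (hw0 i) hs.le) hsum fun i _ => hz i, fun θ hθ => ?_⟩
  refine le_trans ?_ ((hconc θ hθ).le_map_sum (fun i _ => div_nonneg (hw0 i) hs.le) hsum
    fun i _ => hz i)
  have : ∑ i, (w i / s) • G θ (z i) = (∑ i, w i * G θ (z i)) / s := by
    rw [Finset.sum_div]
    exact Finset.sum_congr rfl fun i _ => by rw [smul_eq_mul]; ring
  rw [this, le_div_iff₀ hs]
  linarith [hAθ θ hθ]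

/-- The union of all contractions `r • K` with `0 < r < 1`. -/
def innerPart {E : Type*} [SMul ℝ E] (K : Set E) : Set E :=
  {y | ∃ r : ℝ, 0 < r ∧ r < 1 ∧ ∃ x ∈ K, y = r • x}

/-- Two points of the inner part lie in a common contraction. -/
theorem exists_common_contraction {E : Type*} [AddCommGroup E] [Module ℝ E] {K : Set E}
    (hK : Convex ℝ K) (h0 : (0 : E) ∈ K) {r R : ℝ} (hr : 0 < r) (hrR : r ≤ R) {x : E}
    (hx : x ∈ K) : ∃ x' ∈ K, r • x = R • x' := by
  have hR : 0 < R := hr.trans_le hrR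
  refine ⟨(r / R) • x, hK.smul_mem_of_zero_mem h0 hx
    ⟨by positivity, (div_le_one hR).2 hrR⟩, ?_⟩
  rw [smul_smul, mul_div_cancel₀ _ hR.ne']

theorem convex_innerPart {E : Type*} [AddCommGroup E] [Module ℝ E] {K : Set E}
    (hK : Convex ℝ K) (h0 : (0 : E) ∈ K) : Convex ℝ (innerPart K) := by
  rintro _ ⟨r, hr0, hr1, x, hx, rfl⟩ _ ⟨s, hs0, hs1, y, hy, rfl⟩ a b ha hb hab
  obtain ⟨x', hx', ex⟩ := exists_common_contraction hK h0 hr0 (le_max_left r s) hx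
  obtain ⟨y', hy', ey⟩ := exists_common_contraction hK h0 hs0 (le_max_right r s) hy
  refine ⟨max r s, hr0.trans_le (le_max_left _ _), max_lt hr1 hs1, a • x' + b • y',
    hK hx' hy' ha hb hab, ?_⟩
  rw [ex, ey, smul_add, smul_comm a, smul_comm b]

/-- A minimax theorem for functions that are only controlled on the contractions of `K`. -/
theorem exists_minimax_value {α E : Type*} [NormedAddCommGroup E] [NormedSpace ℝ E]
    {Θ : Set α} (hΘ : Θ.Nonempty) {K : Set E} (hK : IsCompact K) (hKc : Convex ℝ K)
    (h0 : (0 : E) ∈ K) {G : α → E → ℝ}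
    (hcont : ∀ θ ∈ Θ, ∀ r : ℝ, 0 < r → r < 1 → ContinuousOn (fun y => G θ (r • y)) K)
    (hconc : ∀ θ ∈ Θ, ConcaveOn ℝ (innerPart K) (G θ)) (hzero : ∀ θ ∈ Θ, G θ 0 = 0)
    (hconv : ∀ θ₁ ∈ Θ, ∀ θ₂ ∈ Θ, ∀ t : ℝ, 0 ≤ t → t ≤ 1 → ∃ θ ∈ Θ, ∀ y ∈ innerPart K,
      G θ y ≤ t * G θ₁ y + (1 - t) * G θ₂ y)
    (hseq : ∀ θs : ℕ → α, (∀ k, θs k ∈ Θ) → ∃ θ ∈ Θ, ∃ φ : ℕ → ℕ, StrictMono φ ∧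
      ∀ y ∈ innerPart K, ∀ a : ℝ, (∀ᶠ k in atTop, G (θs (φ k)) y ≤ a) → G θ y ≤ a) :
    ∃ v : ℝ, ∃ θhat ∈ Θ, ∃ yhat ∈ K, (∀ y ∈ innerPart K, G θhat y ≤ v) ∧
      ∀ θ ∈ Θ, ∀ r : ℝ, 0 < r → r < 1 → r * v ≤ G θ (r • yhat) := by
  obtain ⟨θ₀, hθ₀⟩ := id hΘ
  let T : Set ℝ := {a | ∃ y ∈ K, ∀ θ ∈ Θ, ∀ r : ℝ, 0 < r → r < 1 → r * a ≤ G θ (r • y)}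
  have hTne : T.Nonempty := ⟨0, 0, h0, fun θ hθ r _ _ => by simp [hzero θ hθ]⟩
  have hTb : BddAbove T := by
    obtain ⟨B, hB⟩ := hK.bddAbove_image (hcont θ₀ hθ₀ 2⁻¹ (by norm_num) (by norm_num))
    refine ⟨2 * B, ?_⟩
    rintro a ⟨y, hy, hya⟩
    have h1 := hya θ₀ hθ₀ 2⁻¹ (by norm_num) (by norm_num)
    have h2 : G θ₀ ((2⁻¹ : ℝ) • y) ≤ B := hB (mem_image_of_mem _ hy)
    linarith
  set v := sSup T with hv
  have hvT : v ∈ T := by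
    obtain ⟨a, -, ha, haT⟩ := exists_seq_tendsto_sSup hTne hTb
    choose y hyK hy using haT
    obtain ⟨yhat, hyhat, φ, hφ, hlim⟩ := hK.tendsto_subseq hyK
    refine ⟨yhat, hyhat, fun θ hθ r hr0 hr1 => ?_⟩
    have hlim' : Tendsto (y ∘ φ) atTop (𝓝[K] yhat) :=
      tendsto_nhdsWithin_iff.2 ⟨hlim, Eventually.of_forall fun k => hyK _⟩
    refine le_of_tendsto_of_tendsto' ((ha.comp hφ.tendsto_atTop).const_mul r)
      ((hcont θ hθ r hr0 hr1 yhat hyhat).tendsto.comp hlim') fun k => ?_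
    exact hy (φ k) θ hθ r hr0 hr1
  have hS := convex_innerPart hKc h0
  have hfin : ∀ (m : ℕ) (z : ℕ → E), (∀ i, z i ∈ innerPart K) → ∀ δ > 0,
      ∃ θ ∈ Θ, ∀ i < m, G θ (z i) ≤ v + δ := by
    intro m z hz δ hδ
    by_contra! hcon
    obtain ⟨y, hyS, hy⟩ := exists_forall_le_of_forall_exists_le (ι := Fin m) hΘ
      (z := fun i => z i) (fun i => hz i) hconc hconv (c := v + δ) (fun θ hθ => by
        obtain ⟨i, him, hi⟩ := hcon θ hθ
        exact ⟨⟨i, him⟩, hi.le⟩)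
    obtain ⟨s, hs0, hs1, x, hx, rfl⟩ := hyS
    have h0S : (0 : E) ∈ innerPart K := ⟨s, hs0, hs1, 0, h0, by simp⟩
    have : v + δ ∈ T := by
      refine ⟨s • x, hKc.smul_mem_of_zero_mem h0 hx ⟨hs0.le, hs1.le⟩, fun θ hθ r hr0 hr1 => ?_⟩
      have hcc := (hconc θ hθ).2 (x := s • x) ⟨s, hs0, hs1, x, hx, rfl⟩ h0S hr0.le
        (sub_nonneg.2 hr1.le) (by ring)
      simp only [smul_zero, add_zero, mul_zero, hzero θ hθ, smul_eq_mul] at hcc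
      exact (mul_le_mul_of_nonneg_left (hy θ hθ) hr0.le).trans hcc
    have := le_csSup hTb this
    linarith
  obtain ⟨D, hDK, hDc, hDd⟩ := hK.isSeparable.exists_countable_dense_subset
  have hDne : D.Nonempty := by
    rw [← closure_nonempty_iff]; exact ⟨0, hDd h0⟩
  obtain ⟨x, rfl⟩ := hDc.exists_eq_range hDne
  let ρ : ℕ → ℝ := fun n => 1 - 1 / ((n : ℝ) + 2)
  have hρ0 : ∀ n, 0 < ρ n := fun n => by
    have : 1 / ((n : ℝ) + 2) < 1 := by
      rw [div_lt_one (by positivity)]; linarith [(n.cast_nonneg : (0 : ℝ) ≤ n)]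
    simp only [ρ]; linarith
  have hρ1 : ∀ n, ρ n < 1 := fun n => by
    have : (0 : ℝ) < 1 / ((n : ℝ) + 2) := by positivity
    simp only [ρ]; linarith
  let z : ℕ → E := fun j => ρ j.unpair.1 • x j.unpair.2
  have hz : ∀ j, z j ∈ innerPart K := fun j =>
    ⟨_, hρ0 _, hρ1 _, _, hDK (mem_range_self _), rfl⟩
  choose θs hθs hθsle using fun m : ℕ => hfin m z hz (1 / ((m : ℝ) + 1)) (by positivity)
  obtain ⟨θhat, hθhat, φ, hφ, hlsc⟩ := hseq θs hθs
  obtain ⟨yhat, hyhat, hyv⟩ := hvT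
  refine ⟨v, θhat, hθhat, yhat, hyhat, ?_, hyv⟩
  have hzle : ∀ j, G θhat (z j) ≤ v := by
    intro j
    refine le_of_forall_pos_le_add fun δ hδ => hlsc _ (hz j) _ ?_
    have h1 : ∀ᶠ k in atTop, j < φ k := hφ.tendsto_atTop.eventually_gt_atTop j
    have h2 : ∀ᶠ k in atTop, 1 / ((φ k : ℝ) + 1) < δ :=
      (tendsto_one_div_add_atTop_nhds_zero_nat.comp hφ.tendsto_atTop).eventually_lt_const hδ
    filter_upwards [h1, h2] with k hk1 hk2
    linarith [hθsle (φ k) j hk1]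
  rintro _ ⟨r, hr0, hr1, y, hy, rfl⟩
  obtain ⟨n, hn⟩ := exists_nat_one_div_lt (sub_pos.2 hr1)
  have hrn : r ≤ ρ n := by
    have : 1 / ((n : ℝ) + 2) ≤ 1 / ((n : ℝ) + 1) := by gcongr; norm_num
    simp only [ρ]; linarith
  obtain ⟨y', hy', he⟩ := exists_common_contraction hKc h0 hr0 hrn hy
  rw [he]
  obtain ⟨w, hw, hwl⟩ := mem_closure_iff_seq_limit.1 (hDd hy')
  have hwl' : Tendsto w atTop (𝓝[K] y') :=
    tendsto_nhdsWithin_iff.2 ⟨hwl, Eventually.of_forall fun k => hDK (hw k)⟩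
  refine le_of_tendsto' ((hcont θhat hθhat (ρ n) (hρ0 n) (hρ1 n) y' hy').tendsto.comp hwl')
    fun k => ?_
  obtain ⟨i, hi⟩ := hw k
  have := hzle (Nat.pair n i)
  simpa [z, hi] using this

/-- The utility function: `log x` for `p = 0`, and `(x ^ p - 1) / p` otherwise. -/
def util (p x : ℝ) : ℝ := if p = 0 then Real.log x else p⁻¹ * x ^ p - p⁻¹

theorem util_one (p : ℝ) : util p 1 = 0 := by simp [util]

theorem hasDerivAt_util (p : ℝ) {x : ℝ} (hx : 0 < x) : HasDerivAt (util p) (x ^ (p - 1)) x := by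
  by_cases hp : p = 0
  · have : util p = Real.log := by ext y; simp [util, hp]
    rw [this, hp, zero_sub, Real.rpow_neg_one]
    exact Real.hasDerivAt_log hx.ne'
  · have : util p = fun y => p⁻¹ * y ^ p - p⁻¹ := by ext y; simp [util, hp]
    rw [this]
    exact (((Real.hasDerivAt_rpow_const (p := p) (Or.inl hx.ne')).const_mul p⁻¹).sub_const
      p⁻¹).congr_deriv (inv_mul_cancel_left₀ hp _)

theorem continuousOn_util (p : ℝ) : ContinuousOn (util p) (Ioi 0) := fun _ hx =>
  (hasDerivAt_util p hx).continuousAt.continuousWithinAt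

theorem measurable_util (p : ℝ) : Measurable (util p) := by
  unfold util
  split_ifs <;> fun_prop

theorem concaveOn_util {p : ℝ} (hp : p < 1) : ConcaveOn ℝ (Ioi 0) (util p) := by
  refine AntitoneOn.concaveOn_of_deriv (convex_Ioi 0) (continuousOn_util p) ?_ ?_
  · rw [interior_Ioi]
    exact fun x hx => (hasDerivAt_util p hx).differentiableAt.differentiableWithinAt
  · rw [interior_Ioi]
    intro x hx y hy hxy
    rw [(hasDerivAt_util p hx).deriv, (hasDerivAt_util p hy).deriv]
    exact Real.rpow_le_rpow_of_nonpos hx hxy (by linarith)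

theorem concaveOn_util_of_pos {p : ℝ} (hp0 : 0 < p) (hp : p < 1) :
    ConcaveOn ℝ (Ici 0) (util p) := by
  have : util p = fun y => p⁻¹ • y ^ p - p⁻¹ := by ext y; simp [util, hp0.ne']
  rw [this]
  exact ((Real.concaveOn_rpow hp0.le hp.le).smul (inv_nonneg.2 hp0.le)).sub
    (convexOn_const _ (convex_Ici 0))

theorem monotoneOn_util (p : ℝ) : MonotoneOn (util p) (Ioi 0) := by
  refine monotoneOn_of_deriv_nonneg (convex_Ioi 0) (continuousOn_util p) ?_ ?_
  · rw [interior_Ioi]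
    exact fun x hx => (hasDerivAt_util p hx).differentiableAt.differentiableWithinAt
  · rw [interior_Ioi]
    intro x hx
    rw [(hasDerivAt_util p hx).deriv]
    exact Real.rpow_nonneg (le_of_lt hx) _

theorem abs_util_sub_le {p η : ℝ} (hp : p < 1) (hη : 0 < η) :
    ∃ C, 0 ≤ C ∧ ∀ x, η ≤ x → |util p x - (x - 1)| ≤ C * (x - 1) ^ 2 := by
  set m := min η 1 with hm
  have hm0 : 0 < m := lt_min hη one_pos
  refine ⟨(1 - p) * m ^ (p - 2), mul_nonneg (by linarith) (Real.rpow_nonneg hm0.le _), ?_⟩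
  have h1 : (1 : ℝ) ∈ Ici m := mem_Ici.2 (min_le_right _ _)
  have hder : ∀ x ∈ Ici m, |x ^ (p - 1) - 1| ≤ (1 - p) * m ^ (p - 2) * |x - 1| := by
    intro x hx
    have hC : ∀ y ∈ Ici m, ‖(p - 1) * y ^ (p - 1 - 1)‖ ≤ (1 - p) * m ^ (p - 2) := by
      intro y hy
      have hy0 : 0 < y := hm0.trans_le hy
      rw [norm_mul, Real.norm_eq_abs, Real.norm_eq_abs, abs_of_neg (by linarith),
        abs_of_pos (Real.rpow_pos_of_pos hy0 _), neg_sub]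
      refine mul_le_mul_of_nonneg_left ?_ (by linarith)
      rw [show p - 1 - 1 = p - 2 by ring]
      exact Real.rpow_le_rpow_of_nonpos hm0 hy (by linarith)
    have := (convex_Ici m).norm_image_sub_le_of_norm_hasDerivWithin_le
      (f := fun y : ℝ => y ^ (p - 1))
      (fun y hy => (Real.hasDerivAt_rpow_const
        (Or.inl (hm0.trans_le hy).ne')).hasDerivWithinAt) hC h1 hx
    simpa using this
  intro x hx
  have hxm : x ∈ Ici m := mem_Ici.2 ((min_le_left _ _).trans hx)
  have hsub : uIcc 1 x ⊆ Ici m := by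
    intro y hy
    exact (le_min h1 hxm).trans hy.1
  have := (convex_uIcc 1 x).norm_image_sub_le_of_norm_hasDerivWithin_le
    (f := fun y : ℝ => util p y - (y - 1)) (f' := fun y => y ^ (p - 1) - 1)
    (C := (1 - p) * m ^ (p - 2) * |x - 1|)
    (fun y hy => ((hasDerivAt_util p (hm0.trans_le (hsub hy))).sub
      ((hasDerivAt_id y).sub_const 1)).hasDerivWithinAt)
    (fun y hy => (hder y (hsub hy)).trans (by
      refine mul_le_mul_of_nonneg_left ?_
        (mul_nonneg (by linarith) (Real.rpow_nonneg hm0.le _))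
      exact abs_sub_left_of_mem_uIcc hy)) left_mem_uIcc right_mem_uIcc
  simp only [util_one, sub_self, sub_zero, Real.norm_eq_abs] at this
  rwa [mul_assoc, ← sq, sq_abs] at this

theorem kintegrand_nonneg {d : ℕ} (p ε : ℝ) (z : EuclideanSpace ℝ (Fin d)) :
    0 ≤ Kintegrand p ε z := by
  unfold Kintegrand
  have h1 : 0 ≤ Real.log (1 + ‖z‖) := Real.log_nonneg (by linarith [norm_nonneg z])
  split_ifs <;> positivity

theorem measurable_kintegrand {d : ℕ} (p ε : ℝ) :
    Measurable (Kintegrand p ε : EuclideanSpace ℝ (Fin d) → ℝ) := by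
  unfold Kintegrand
  split_ifs <;> fun_prop

/-- The utility function grows at most like the integrand in the definition of `K`. -/
theorem abs_util_le {d : ℕ} {p ε η R : ℝ} (hp : p < 1) (hε : 0 < ε) (hη : 0 < η) (hR : 0 ≤ R) :
    ∃ C, 0 ≤ C ∧ ∀ (x : ℝ) (z : EuclideanSpace ℝ (Fin d)), η ≤ x → x ≤ 1 + R * ‖z‖ →
      |util p x| ≤ C * (1 + Kintegrand p ε z) := by
  suffices h : ∃ C, 0 ≤ C ∧ ∀ z : EuclideanSpace ℝ (Fin d),
      util p (1 + R * ‖z‖) ≤ C * (1 + Kintegrand p ε z) by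
    obtain ⟨C, hC, h⟩ := h
    refine ⟨C + |util p η|, by positivity, fun x z hx hxz => ?_⟩
    have hK := kintegrand_nonneg p ε z
    have hx0 : 0 < x := hη.trans_le hx
    have h1 := monotoneOn_util p hη hx0 hx
    have h2 := monotoneOn_util p hx0 (hx0.trans_le hxz) hxz
    have h3 := h z
    have h4 := neg_abs_le (util p η)
    have h5 : |util p η| * 1 ≤ |util p η| * (1 + Kintegrand p ε z) :=
      mul_le_mul_of_nonneg_left (by linarith) (abs_nonneg _)
    have h6 : 0 ≤ C * (1 + Kintegrand p ε z) := by positivity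
    rw [abs_le]
    constructor <;> linarith [abs_nonneg (util p η)]
  rcases lt_trichotomy p 0 with hp0 | rfl | hp0
  · refine ⟨-p⁻¹, by simpa using hp0.le, fun z => ?_⟩
    have hK := kintegrand_nonneg p ε z
    have h1 : 0 ≤ (1 + R * ‖z‖) ^ p := by positivity
    have h2 : p⁻¹ < 0 := inv_neg''.2 hp0
    simp only [util, hp0.ne, if_false]
    nlinarith
  · refine ⟨1 + Real.log (1 + R), by
      have := Real.log_nonneg (show 1 ≤ 1 + R by linarith); positivity, fun z => ?_⟩
    have hK := kintegrand_nonneg 0 ε z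
    have hz := norm_nonneg z
    have hlR := Real.log_nonneg (show 1 ≤ 1 + R by linarith)
    have h1 : Real.log (1 + R * ‖z‖) ≤ Real.log (1 + R) + Real.log (1 + ‖z‖) := by
      rw [← Real.log_mul (by positivity) (by positivity)]
      exact Real.log_le_log (by positivity) (by nlinarith)
    have h2 : Real.log (1 + ‖z‖) ≤ 1 + Kintegrand 0 ε z := by
      simp only [Kintegrand, if_true]
      have h3 := Real.log_le_sub_one_of_pos (show 0 < 1 + ‖z‖ by positivity)
      rcases le_total (‖z‖ ^ 2) (Real.log (1 + ‖z‖)) with h | h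
      · rw [min_eq_left h]
        nlinarith
      · rw [min_eq_right h]; linarith
    simp only [util, if_true]
    nlinarith
  · refine ⟨p⁻¹ * (1 + R ^ p), by positivity, fun z => ?_⟩
    have hK := kintegrand_nonneg p ε z
    have hz := norm_nonneg z
    have h1 : (1 + R * ‖z‖) ^ p ≤ 1 + R ^ p * ‖z‖ ^ p := by
      have := Real.rpow_add_le_add_rpow zero_le_one (mul_nonneg hR hz) hp0.le hp.le
      rwa [Real.one_rpow, Real.mul_rpow hR hz] at this
    have h2 : ‖z‖ ^ p ≤ 1 + Kintegrand p ε z := by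
      rcases le_total ‖z‖ 1 with h | h
      · have := Real.rpow_le_one hz h hp0.le
        linarith
      · have h3 : ‖z‖ ^ p ≤ Kintegrand p ε z := by
          simp only [Kintegrand, hp0.ne', hp0, if_true, if_false]
          refine le_min ?_ (Real.rpow_le_rpow_of_exponent_le h (by nlinarith))
          rw [← Real.rpow_two]
          exact Real.rpow_le_rpow_of_exponent_le h (by linarith)
        linarith
    simp only [util, hp0.ne', if_false]
    have hRp : 0 ≤ R ^ p := by positivity
    have h3 : (1 + R * ‖z‖) ^ p ≤ 1 + (1 + R ^ p) * (1 + Kintegrand p ε z) := by nlinarith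
    have h4 := mul_le_mul_of_nonneg_left h3 (inv_nonneg.2 hp0.le)
    linarith

theorem dotp_eq_inner {d : ℕ} (y z : EuclideanSpace ℝ (Fin d)) : dotp y z = inner ℝ y z := by
  simp [dotp, PiLp.inner_apply, mul_comm]

theorem abs_dotp_le {d : ℕ} (y z : EuclideanSpace ℝ (Fin d)) : |dotp y z| ≤ ‖y‖ * ‖z‖ := by
  rw [dotp_eq_inner]; exact abs_real_inner_le_norm y z

theorem continuous_dotp {d : ℕ} :
    Continuous fun q : EuclideanSpace ℝ (Fin d) × EuclideanSpace ℝ (Fin d) => dotp q.1 q.2 := by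
  simp only [dotp_eq_inner]
  exact continuous_inner

theorem dotp_smul_left {d : ℕ} (r : ℝ) (y z : EuclideanSpace ℝ (Fin d)) :
    dotp (r • y) z = r * dotp y z := by
  rw [dotp_eq_inner, dotp_eq_inner, real_inner_smul_left]

theorem dotp_add_left {d : ℕ} (x y z : EuclideanSpace ℝ (Fin d)) :
    dotp (x + y) z = dotp x z + dotp y z := by
  rw [dotp_eq_inner, dotp_eq_inner, dotp_eq_inner, inner_add_left]

theorem dotp_smul_right {d : ℕ} (r : ℝ) (y z : EuclideanSpace ℝ (Fin d)) :
    dotp y (r • z) = r * dotp y z := by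
  rw [dotp_eq_inner, dotp_eq_inner, real_inner_smul_right]

theorem dotp_add_right {d : ℕ} (x y z : EuclideanSpace ℝ (Fin d)) :
    dotp x (y + z) = dotp x y + dotp x z := by
  rw [dotp_eq_inner, dotp_eq_inner, dotp_eq_inner, inner_add_right]

/-- The real-valued version of `Ifun`. -/
def jfun {d : ℕ} (p : ℝ) (h : EuclideanSpace ℝ (Fin d) → EuclideanSpace ℝ (Fin d))
    (y z : EuclideanSpace ℝ (Fin d)) : ℝ :=
  util p (1 + dotp y z) - dotp y (h z)

/-- The weight `|z|² ∧ 1`. -/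
def sqw {d : ℕ} (z : EuclideanSpace ℝ (Fin d)) : ℝ := min (‖z‖ ^ 2) 1

theorem sqw_nonneg {d : ℕ} (z : EuclideanSpace ℝ (Fin d)) : 0 ≤ sqw z :=
  le_min (by positivity) zero_le_one

theorem continuous_sqw {d : ℕ} : Continuous (sqw : EuclideanSpace ℝ (Fin d) → ℝ) := by
  unfold sqw; fun_prop

theorem measurable_dotp_right {d : ℕ} (y : EuclideanSpace ℝ (Fin d)) :
    Measurable (dotp y) :=
  (continuous_dotp.comp (Continuous.prodMk_right y)).measurable

theorem measurable_jfun {d : ℕ} (p : ℝ)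
    {h : EuclideanSpace ℝ (Fin d) → EuclideanSpace ℝ (Fin d)} (hm : Measurable h)
    (y : EuclideanSpace ℝ (Fin d)) : Measurable (jfun p h y) :=
  ((measurable_util p).comp (measurable_const.add (measurable_dotp_right y))).sub
    ((measurable_dotp_right y).comp hm)

theorem jfun_bounds {d : ℕ} {p ε η R : ℝ} (hp : p < 1) (hε : 0 < ε) (hη : 0 < η) (hR : 0 ≤ R)
    {h : EuclideanSpace ℝ (Fin d) → EuclideanSpace ℝ (Fin d)} (hh : IsTruncation h) :
    ∃ C, ∀ y z, ‖y‖ ≤ R → η ≤ 1 + dotp y z →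
      -(C * sqw z) ≤ jfun p h y z ∧ |jfun p h y z| ≤ C * (sqw z + Kintegrand p ε z) := by
  obtain ⟨C₁, hC₁, h₁⟩ := abs_util_sub_le hp hη
  obtain ⟨C₂, hC₂, h₂⟩ := abs_util_le (d := d) hp hε hη hR
  obtain ⟨M, hM⟩ := hh.bounded
  have hM0 : 0 ≤ M := (norm_nonneg _).trans (hM 0)
  obtain ⟨δ₀, hδ₀, hid⟩ := hh.eq_id_near_zero
  set δ := min δ₀ 1 with hδdef
  have hδ : 0 < δ := lt_min hδ₀ one_pos
  have hδ1 : δ ≤ 1 := min_le_right _ _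
  set B := |util p η| + C₂ + R * M with hB
  have hB0 : 0 ≤ B := by positivity
  refine ⟨C₁ * R ^ 2 + B / δ ^ 2 + C₂, fun y z hy hx => ?_⟩
  have hK := kintegrand_nonneg p ε z
  have hw := sqw_nonneg z
  have hyz : |dotp y z| ≤ R * ‖z‖ :=
    (abs_dotp_le y z).trans (mul_le_mul_of_nonneg_right hy (norm_nonneg _))
  have hBδ : 0 ≤ B / δ ^ 2 := by positivity
  rcases lt_or_ge ‖z‖ δ with hz | hz
  · have hwz : sqw z = ‖z‖ ^ 2 := by
      refine min_eq_left ?_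
      have := norm_nonneg z
      nlinarith
    have hJ : |jfun p h y z| ≤ C₁ * R ^ 2 * sqw z := by
      have h3 := h₁ _ hx
      rw [add_sub_cancel_left] at h3
      rw [jfun, hid z (hz.trans_le (min_le_left _ _)), hwz, mul_assoc, ← mul_pow]
      refine h3.trans (mul_le_mul_of_nonneg_left ?_ hC₁)
      rw [← sq_abs]
      exact pow_le_pow_left₀ (abs_nonneg _) hyz 2
    have h4 := mul_nonneg hBδ hw
    have h5 := mul_nonneg hC₂ hw
    have h6 : 0 ≤ (C₁ * R ^ 2 + B / δ ^ 2 + C₂) * Kintegrand p ε z := by positivity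
    constructor
    · linarith [neg_abs_le (jfun p h y z)]
    · linarith
  · have hwz : δ ^ 2 ≤ sqw z := by
      refine le_min (pow_le_pow_left₀ hδ.le hz 2) (by nlinarith)
    have hBw : B ≤ B / δ ^ 2 * sqw z := by
      rw [div_mul_eq_mul_div, le_div_iff₀ (by positivity)]
      exact mul_le_mul_of_nonneg_left hwz hB0
    have hyh : |dotp y (h z)| ≤ R * M :=
      (abs_dotp_le y _).trans (mul_le_mul hy (hM z) (norm_nonneg _) hR)
    have h5 := mul_nonneg hC₂ hw
    have h6 : 0 ≤ C₁ * R ^ 2 * sqw z := by positivity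
    have h7 := monotoneOn_util p hη (hη.trans_le hx) hx
    have h8 := h₂ (1 + dotp y z) z hx (by linarith [le_abs_self (dotp y z)])
    have h9 : 0 ≤ (C₁ * R ^ 2 + B / δ ^ 2) * Kintegrand p ε z := by positivity
    obtain ⟨h10, h11⟩ := abs_le.1 hyh
    constructor
    · rw [jfun]
      linarith [neg_abs_le (util p η)]
    · rw [jfun]
      refine (abs_sub _ _).trans ?_
      linarith [abs_nonneg (util p η)]

theorem integrable_jfun {d : ℕ} {p ε η : ℝ} (hp : p < 1) (hε : 0 < ε) (hη : 0 < η)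
    {h : EuclideanSpace ℝ (Fin d) → EuclideanSpace ℝ (Fin d)} (hh : IsTruncation h)
    {F : Measure (EuclideanSpace ℝ (Fin d))} (hw : Integrable sqw F)
    (hk : Integrable (Kintegrand p ε) F) {y : EuclideanSpace ℝ (Fin d)}
    (hy : ∀ᵐ z ∂F, η ≤ 1 + dotp y z) : Integrable (jfun p h y) F := by
  obtain ⟨C, hC⟩ := jfun_bounds (p := p) hp hε hη (norm_nonneg y) hh
  refine ((hw.add hk).const_mul C).mono' (measurable_jfun p hh.measurable y).aestronglyMeasurable ?_
  filter_upwards [hy] with z hz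
  exact (hC y z le_rfl hz).2

/-- Contractions of admissible points stay away from the singularity of the utility function. -/
theorem le_one_add_dotp_smul {d : ℕ} {r : ℝ} (hr : 0 ≤ r) {y z : EuclideanSpace ℝ (Fin d)}
    (hz : 0 ≤ 1 + dotp y z) : 1 - r ≤ 1 + dotp (r • y) z := by
  rw [dotp_smul_left]
  nlinarith

/-- The finite part of `gTheta`. -/
def greal {d : ℕ} (p : ℝ) (h : EuclideanSpace ℝ (Fin d) → EuclideanSpace ℝ (Fin d))
    (θ : Triple d) (y : EuclideanSpace ℝ (Fin d)) : ℝ :=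
  dotp y θ.1 + (p - 1) / 2 * quadf θ.2.1 y + ∫ z, jfun p h y z ∂θ.2.2

theorem continuous_quadf {d : ℕ} (c : Matrix (Fin d) (Fin d) ℝ) : Continuous (quadf c) := by
  unfold quadf; fun_prop

theorem continuousOn_greal_smul {d : ℕ} {p ε : ℝ} (hp : p < 1) (hε : 0 < ε)
    {h : EuclideanSpace ℝ (Fin d) → EuclideanSpace ℝ (Fin d)} (hh : IsTruncation h)
    {θ : Triple d} (hw : Integrable sqw θ.2.2) (hk : Integrable (Kintegrand p ε) θ.2.2)
    {K : Set (EuclideanSpace ℝ (Fin d))} (hKb : Bornology.IsBounded K)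
    (hK : ∀ y ∈ K, ∀ᵐ z ∂θ.2.2, 0 ≤ 1 + dotp y z) {r : ℝ} (hr0 : 0 < r) (hr1 : r < 1) :
    ContinuousOn (fun y => greal p h θ (r • y)) K := by
  obtain ⟨R, hR0, hR⟩ := hKb.exists_pos_norm_le
  obtain ⟨C, hC⟩ := jfun_bounds (p := p) hp hε (sub_pos.2 hr1) hR0.le hh
  have hsm : Continuous fun y : EuclideanSpace ℝ (Fin d) => r • y := continuous_const_smul r
  have hdot : ∀ z : EuclideanSpace ℝ (Fin d), Continuous fun y => dotp (r • y) z := fun z =>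
    continuous_dotp.comp (hsm.prodMk continuous_const)
  unfold greal
  refine ContinuousOn.add (((hdot _).add
    (((continuous_quadf _).comp hsm).const_mul _)).continuousOn) fun y hy => ?_
  refine continuousWithinAt_of_dominated (bound := fun z => C * (sqw z + Kintegrand p ε z))
    (Eventually.of_forall fun x => (measurable_jfun p hh.measurable _).aestronglyMeasurable)
    ?_ ((hw.add hk).const_mul C) ?_
  · filter_upwards [self_mem_nhdsWithin] with x hx
    filter_upwards [hK x hx] with z hz
    refine (hC (r • x) z ?_ (le_one_add_dotp_smul hr0.le hz)).2
    rw [norm_smul, Real.norm_of_nonneg hr0.le]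
    nlinarith [hR x hx, norm_nonneg x]
  · filter_upwards [hK y hy] with z hz
    have h1 : 0 < 1 + dotp (r • y) z :=
      (sub_pos.2 hr1).trans_le (le_one_add_dotp_smul hr0.le hz)
    refine ContinuousAt.continuousWithinAt ?_
    unfold jfun
    refine ContinuousAt.sub ?_ (hdot (h z)).continuousAt
    exact ContinuousAt.comp (f := fun y => 1 + dotp (r • y) z)
      (hasDerivAt_util p h1).continuousAt ((hdot z).const_add 1).continuousAt

theorem quadf_nonneg {d : ℕ} {c : Matrix (Fin d) (Fin d) ℝ} (hc : c.PosSemidef)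
    (y : EuclideanSpace ℝ (Fin d)) : 0 ≤ quadf c y := by
  have := hc.dotProduct_mulVec_nonneg (fun i => y i)
  simp only [dotProduct, Matrix.mulVec, Pi.star_apply, star_trivial] at this
  refine this.trans_eq ?_
  unfold quadf
  refine Finset.sum_congr rfl fun i _ => ?_
  rw [Finset.mul_sum]
  exact Finset.sum_congr rfl fun j _ => by ring

theorem quadf_smul {d : ℕ} (c : Matrix (Fin d) (Fin d) ℝ) (r : ℝ)
    (y : EuclideanSpace ℝ (Fin d)) : quadf c (r • y) = r ^ 2 * quadf c y := by
  unfold quadf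
  simp only [Finset.mul_sum, PiLp.smul_apply, smul_eq_mul]
  exact Finset.sum_congr rfl fun i _ => Finset.sum_congr rfl fun j _ => by ring

theorem quadf_combo_le {d : ℕ} {c : Matrix (Fin d) (Fin d) ℝ} (hc : c.PosSemidef)
    (x y : EuclideanSpace ℝ (Fin d)) {a b : ℝ} (ha : 0 ≤ a) (hb : 0 ≤ b) (hab : a + b = 1) :
    quadf c (a • x + b • y) ≤ a * quadf c x + b * quadf c y := by
  obtain rfl : b = 1 - a := by linarith
  have h1 : a * quadf c x + (1 - a) * quadf c y - quadf c (a • x + (1 - a) • y)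
      = a * (1 - a) * quadf c (x - y) := by
    unfold quadf
    simp only [Finset.mul_sum, ← Finset.sum_add_distrib, ← Finset.sum_sub_distrib,
      PiLp.smul_apply, PiLp.add_apply, PiLp.sub_apply, smul_eq_mul]
    exact Finset.sum_congr rfl fun i _ => Finset.sum_congr rfl fun j _ => by ring
  have h2 := mul_nonneg (mul_nonneg ha hb) (quadf_nonneg hc (x - y))
  linarith

theorem jfun_concave {d : ℕ} {p : ℝ} (hp : p < 1)
    (h : EuclideanSpace ℝ (Fin d) → EuclideanSpace ℝ (Fin d))
    {x y z : EuclideanSpace ℝ (Fin d)} (hx : 0 < 1 + dotp x z) (hy : 0 < 1 + dotp y z)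
    {a b : ℝ} (ha : 0 ≤ a) (hb : 0 ≤ b) (hab : a + b = 1) :
    a * jfun p h x z + b * jfun p h y z ≤ jfun p h (a • x + b • y) z := by
  have := (concaveOn_util hp).2 hx hy ha hb hab
  simp only [smul_eq_mul] at this
  simp only [jfun, dotp_add_left, dotp_smul_left]
  rw [show 1 + (a * dotp x z + b * dotp y z) = a * (1 + dotp x z) + b * (1 + dotp y z) by
    linear_combination -hab]
  linarith

theorem greal_concave {d : ℕ} {p ε η : ℝ} (hp : p < 1) (hε : 0 < ε) (hη : 0 < η)
    {h : EuclideanSpace ℝ (Fin d) → EuclideanSpace ℝ (Fin d)} (hh : IsTruncation h)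
    {θ : Triple d} (hc : θ.2.1.PosSemidef) (hw : Integrable sqw θ.2.2)
    (hk : Integrable (Kintegrand p ε) θ.2.2) {x y : EuclideanSpace ℝ (Fin d)}
    (hx : ∀ᵐ z ∂θ.2.2, η ≤ 1 + dotp x z) (hy : ∀ᵐ z ∂θ.2.2, η ≤ 1 + dotp y z)
    {a b : ℝ} (ha : 0 ≤ a) (hb : 0 ≤ b) (hab : a + b = 1) :
    a * greal p h θ x + b * greal p h θ y ≤ greal p h θ (a • x + b • y) := by
  have hxy : ∀ᵐ z ∂θ.2.2, η ≤ 1 + dotp (a • x + b • y) z := by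
    filter_upwards [hx, hy] with z h1 h2
    rw [dotp_add_left, dotp_smul_left, dotp_smul_left]
    nlinarith
  have ix := integrable_jfun hp hε hη hh hw hk hx
  have iy := integrable_jfun hp hε hη hh hw hk hy
  have ixy := integrable_jfun hp hε hη hh hw hk hxy
  have hint : a * ∫ z, jfun p h x z ∂θ.2.2 + b * ∫ z, jfun p h y z ∂θ.2.2
      ≤ ∫ z, jfun p h (a • x + b • y) z ∂θ.2.2 := by
    rw [← integral_const_mul, ← integral_const_mul,
      ← integral_add (ix.const_mul a) (iy.const_mul b)]
    refine integral_mono_ae ((ix.const_mul a).add (iy.const_mul b)) ixy ?_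
    filter_upwards [hx, hy] with z h1 h2
    exact jfun_concave hp h (hη.trans_le h1) (hη.trans_le h2) ha hb hab
  have hq := mul_le_mul_of_nonneg_left (quadf_combo_le hc x y ha hb hab)
    (show 0 ≤ (1 - p) / 2 by linarith)
  simp only [greal]
  rw [dotp_add_left, dotp_smul_left, dotp_smul_left]
  linarith

theorem greal_mix {d : ℕ} {p : ℝ}
    {h : EuclideanSpace ℝ (Fin d) → EuclideanSpace ℝ (Fin d)} {θ₁ θ₂ : Triple d}
    {y : EuclideanSpace ℝ (Fin d)} (h₁ : Integrable (jfun p h y) θ₁.2.2)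
    (h₂ : Integrable (jfun p h y) θ₂.2.2) {t : ℝ} (ht0 : 0 ≤ t) (ht1 : t ≤ 1) :
    greal p h (t • θ₁.1 + (1 - t) • θ₂.1, t • θ₁.2.1 + (1 - t) • θ₂.2.1,
      ENNReal.ofReal t • θ₁.2.2 + ENNReal.ofReal (1 - t) • θ₂.2.2) y
      = t * greal p h θ₁ y + (1 - t) * greal p h θ₂ y := by
  have hq : quadf (t • θ₁.2.1 + (1 - t) • θ₂.2.1) y
      = t * quadf θ₁.2.1 y + (1 - t) * quadf θ₂.2.1 y := by
    unfold quadf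
    simp only [Finset.mul_sum, ← Finset.sum_add_distrib, Matrix.add_apply, Matrix.smul_apply,
      smul_eq_mul]
    exact Finset.sum_congr rfl fun i _ => Finset.sum_congr rfl fun j _ => by ring
  simp only [greal]
  rw [integral_add_measure (h₁.smul_measure ENNReal.ofReal_ne_top)
    (h₂.smul_measure ENNReal.ofReal_ne_top), integral_smul_measure, integral_smul_measure,
    ENNReal.toReal_ofReal ht0, ENNReal.toReal_ofReal (sub_nonneg.2 ht1), hq, dotp_add_right,
    dotp_smul_right, dotp_smul_right, smul_eq_mul, smul_eq_mul]
  ring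

theorem mul_util_le {p : ℝ} (hp : p < 1) {l x : ℝ} (hl0 : 0 ≤ l) (hl1 : l ≤ 1) (hx : 0 ≤ x)
    (h : 0 < x ∨ 0 < p) : l * util p x ≤ util p (1 + l * (x - 1)) := by
  have hmain : ∀ s : Set ℝ, ConcaveOn ℝ s (util p) → x ∈ s → 1 ∈ s →
      l * util p x ≤ util p (1 + l * (x - 1)) := by
    intro s hs hxs h1s
    have := hs.2 hxs h1s hl0 (sub_nonneg.2 hl1) (by ring)
    simp only [smul_eq_mul, util_one, mul_zero, add_zero] at this
    rwa [show l * x + (1 - l) * 1 = 1 + l * (x - 1) by ring] at this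
  rcases h with h | h
  · exact hmain _ (concaveOn_util hp) h (mem_Ioi.2 one_pos)
  · exact hmain _ (concaveOn_util_of_pos h hp) hx (mem_Ici.2 zero_le_one)

theorem mul_jfun_le {d : ℕ} {p : ℝ} (hp : p < 1)
    (h : EuclideanSpace ℝ (Fin d) → EuclideanSpace ℝ (Fin d)) {l : ℝ} (hl0 : 0 ≤ l) (hl1 : l ≤ 1)
    {y z : EuclideanSpace ℝ (Fin d)} (hz : 0 ≤ 1 + dotp y z)
    (hpos : 0 < 1 + dotp y z ∨ 0 < p) : l * jfun p h y z ≤ jfun p h (l • y) z := by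
  have := mul_util_le hp hl0 hl1 hz hpos
  rw [add_sub_cancel_left] at this
  simp only [jfun, dotp_smul_left]
  linarith

theorem continuousAt_util {p x : ℝ} (h : 0 < x ∨ 0 < p) : ContinuousAt (util p) x := by
  rcases h with h | h
  · exact (hasDerivAt_util p h).continuousAt
  · have : util p = fun y => p⁻¹ * y ^ p - p⁻¹ := by ext y; simp [util, h.ne']
    rw [this]
    exact ((Real.continuousAt_rpow_const x p (Or.inr h.le)).const_mul _).sub_const _

theorem tendsto_util_zero {p : ℝ} (hp : p ≤ 0) : Tendsto (util p) (𝓝[>] 0) atBot := by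
  rcases hp.eq_or_lt with rfl | hp
  · have : util 0 = Real.log := by ext y; simp [util]
    rw [this]
    exact Real.tendsto_log_nhdsGT_zero
  · have : util p = fun y => p⁻¹ * y ^ p - p⁻¹ := by ext y; simp [util, hp.ne]
    rw [this]
    exact tendsto_atBot_add_const_right _ _
      ((tendsto_rpow_neg_nhdsGT_zero hp).const_mul_atTop_of_neg (inv_neg''.2 hp))

theorem Ifun_of_pos {d : ℕ} {p : ℝ} (h : EuclideanSpace ℝ (Fin d) → EuclideanSpace ℝ (Fin d))
    {y z : EuclideanSpace ℝ (Fin d)} (hpos : 0 < 1 + dotp y z ∨ 0 < p) :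
    Ifun p h y z = (jfun p h y z : EReal) := by
  unfold Ifun jfun util
  rcases hpos with h1 | h1
  · rw [if_pos h1]; split_ifs <;> rfl
  · rw [if_neg h1.not_ge]; simp [h1.ne']

theorem Ifun_of_not_pos {d : ℕ} {p : ℝ}
    (h : EuclideanSpace ℝ (Fin d) → EuclideanSpace ℝ (Fin d))
    {y z : EuclideanSpace ℝ (Fin d)} (hpos : ¬(0 < 1 + dotp y z ∨ 0 < p)) :
    Ifun p h y z = ⊥ := by
  push Not at hpos
  rw [Ifun, if_neg hpos.1.not_gt, if_pos hpos.2]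

theorem eIntegral_coe {α : Type*} [MeasurableSpace α] {F : Measure α} {f : α → EReal} {g : α → ℝ}
    (hfg : ∀ᵐ z ∂F, f z = g z) (hg : Integrable g F) :
    eIntegral F f = ((∫ z, g z ∂F : ℝ) : EReal) := by
  have h1 : ∫⁻ z, (f z).posPart ∂F = ∫⁻ z, ENNReal.ofReal (g z) ∂F := by
    refine lintegral_congr_ae ?_
    filter_upwards [hfg] with z hz
    simp [hz, EReal.posPart]
  have h2 : ∫⁻ z, (-(f z)).posPart ∂F = ∫⁻ z, ENNReal.ofReal (-g z) ∂F := by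
    refine lintegral_congr_ae ?_
    filter_upwards [hfg] with z hz
    rw [hz, ← EReal.coe_neg]
    simp only [EReal.posPart, EReal.coe_ne_top, if_false, EReal.toReal_coe]
  have f1 : ∫⁻ z, ENNReal.ofReal (g z) ∂F ≠ ⊤ := hg.lintegral_lt_top.ne
  have f2 : ∫⁻ z, ENNReal.ofReal (-g z) ∂F ≠ ⊤ := hg.neg.lintegral_lt_top.ne
  rw [integral_eq_lintegral_pos_part_sub_lintegral_neg_part hg, eIntegral, h1, h2]
  generalize ∫⁻ z, ENNReal.ofReal (g z) ∂F = A at f1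
  generalize ∫⁻ z, ENNReal.ofReal (-g z) ∂F = B at f2
  lift A to ℝ≥0 using f1
  lift B to ℝ≥0 using f2
  simp [EReal.coe_nnreal_eq_coe_real]

theorem gTheta_eq_greal {d : ℕ} {p : ℝ}
    {h : EuclideanSpace ℝ (Fin d) → EuclideanSpace ℝ (Fin d)} {θ : Triple d}
    {y : EuclideanSpace ℝ (Fin d)} (hy : ∀ᵐ z ∂θ.2.2, Ifun p h y z = (jfun p h y z : EReal))
    (hi : Integrable (jfun p h y) θ.2.2) : gTheta p h θ y = (greal p h θ y : EReal) := by
  rw [gTheta, gfun, eIntegral_coe hy hi, greal, ← EReal.coe_add]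

theorem integrable_of_le_of_lintegral_neg {α : Type*} [MeasurableSpace α] {F : Measure α}
    {g D : α → ℝ} (hgm : Measurable g) (hD : Integrable D F) (hgD : ∀ᵐ z ∂F, g z ≤ D z)
    (hneg : ∫⁻ z, ENNReal.ofReal (-g z) ∂F ≠ ⊤) : Integrable g F := by
  have hn : Integrable (fun z => max (-g z) 0) F := by
    refine ⟨(hgm.neg.max measurable_const).aestronglyMeasurable, ?_⟩
    rw [hasFiniteIntegral_iff_ofReal (f := fun z => max (-g z) 0)
      (Eventually.of_forall fun z => le_max_right _ _)]
    refine lt_of_eq_of_lt (lintegral_congr fun z => ?_) hneg.lt_top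
    rw [ENNReal.ofReal_max, ENNReal.ofReal_zero, max_eq_left zero_le]
  refine (hD.norm.add hn).mono' hgm.aestronglyMeasurable ?_
  filter_upwards [hgD] with z hz
  simp only [Pi.add_apply, Real.norm_eq_abs]
  rw [abs_le]
  constructor <;> linarith [le_abs_self (D z), abs_nonneg (D z), le_max_left (-g z) 0,
    le_max_right (-g z) 0]

theorem gTheta_le {d : ℕ} {p ε : ℝ} (hp : p < 1) (hε : 0 < ε)
    {h : EuclideanSpace ℝ (Fin d) → EuclideanSpace ℝ (Fin d)} (hh : IsTruncation h)
    {θ : Triple d} (hc : θ.2.1.PosSemidef) (hw : Integrable sqw θ.2.2)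
    (hk : Integrable (Kintegrand p ε) θ.2.2) {y : EuclideanSpace ℝ (Fin d)}
    (hy : ∀ᵐ z ∂θ.2.2, 0 ≤ 1 + dotp y z) {r : ℝ} (hr0 : 0 < r) (hr1 : r < 1) :
    gTheta p h θ y ≤ ((greal p h θ (r • y) / r : ℝ) : EReal) := by
  by_cases hneg : ∫⁻ z, (-(Ifun p h y z)).posPart ∂θ.2.2 = ⊤
  · rw [gTheta, gfun, eIntegral, hneg]
    simp
  have hpos : ∀ᵐ z ∂θ.2.2, 0 < 1 + dotp y z ∨ 0 < p := by
    have hset : MeasurableSet {z : EuclideanSpace ℝ (Fin d) | 0 < 1 + dotp y z ∨ 0 < p} :=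
      (measurableSet_lt measurable_const (measurable_const.add (measurable_dotp_right y))).union
        (MeasurableSet.const _)
    by_contra hcon
    refine hneg (top_le_iff.1 ?_)
    have hm : θ.2.2 {z | ¬(0 < 1 + dotp y z ∨ 0 < p)} ≠ 0 := fun h0 => hcon h0
    calc ⊤ = ∫⁻ z in {z | ¬(0 < 1 + dotp y z ∨ 0 < p)}, ⊤ ∂θ.2.2 := by
            rw [setLIntegral_const, ENNReal.top_mul hm]
      _ = ∫⁻ z in {z | ¬(0 < 1 + dotp y z ∨ 0 < p)}, (-(Ifun p h y z)).posPart ∂θ.2.2 := by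
            refine setLIntegral_congr_fun hset.compl fun z hz => ?_
            simp only [Ifun_of_not_pos h hz, EReal.posPart, EReal.neg_bot, if_true]
      _ ≤ _ := setLIntegral_le_lintegral _ _
  have hIj : ∀ᵐ z ∂θ.2.2, Ifun p h y z = (jfun p h y z : EReal) := by
    filter_upwards [hpos] with z hz using Ifun_of_pos h hz
  have hneg' : ∫⁻ z, ENNReal.ofReal (-jfun p h y z) ∂θ.2.2 ≠ ⊤ := by
    convert hneg using 1
    refine lintegral_congr_ae ?_
    filter_upwards [hIj] with z hz
    rw [hz, ← EReal.coe_neg]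
    simp only [EReal.posPart, EReal.coe_ne_top, if_false, EReal.toReal_coe]
  have hle : ∀ᵐ z ∂θ.2.2, jfun p h y z ≤ jfun p h (r • y) z / r := by
    filter_upwards [hy, hpos] with z h1 h2
    rw [le_div_iff₀ hr0, mul_comm]
    exact mul_jfun_le hp h hr0.le hr1.le h1 h2
  have hir : Integrable (jfun p h (r • y)) θ.2.2 :=
    integrable_jfun hp hε (sub_pos.2 hr1) hh hw hk
      (hy.mono fun z hz => le_one_add_dotp_smul hr0.le hz)
  have hi := integrable_of_le_of_lintegral_neg (measurable_jfun p hh.measurable y)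
    (hir.div_const r) hle hneg'
  rw [gTheta_eq_greal hIj hi, EReal.coe_le_coe_iff, le_div_iff₀ hr0]
  have hint := integral_mono_ae hi (hir.div_const r) hle
  rw [integral_div, le_div_iff₀ hr0] at hint
  have hq := quadf_nonneg hc y
  have hq2 : r ^ 2 * quadf θ.2.1 y ≤ r * quadf θ.2.1 y :=
    mul_le_mul_of_nonneg_right (by nlinarith) hq
  have hq3 := mul_le_mul_of_nonneg_left hq2 (show 0 ≤ (1 - p) / 2 by linarith)
  simp only [greal, quadf_smul, dotp_smul_left]
  linarith

theorem le_gTheta {d : ℕ} {p ε : ℝ} (hp : p < 1) (hε : 0 < ε)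
    {h : EuclideanSpace ℝ (Fin d) → EuclideanSpace ℝ (Fin d)} (hh : IsTruncation h)
    {θ : Triple d} (hw : Integrable sqw θ.2.2)
    (hk : Integrable (Kintegrand p ε) θ.2.2) {y : EuclideanSpace ℝ (Fin d)}
    (hy : ∀ᵐ z ∂θ.2.2, 0 ≤ 1 + dotp y z) {v : ℝ}
    (hv : ∀ r : ℝ, 0 < r → r < 1 → r * v ≤ greal p h θ (r • y)) :
    (v : EReal) ≤ gTheta p h θ y := by
  obtain ⟨b, c, F⟩ := θ
  simp only at hw hk hy
  let ρ : ℕ → ℝ := fun n => 1 - 1 / ((n : ℝ) + 2)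
  have hρh : ∀ n, 2⁻¹ ≤ ρ n := fun n => by
    have : 1 / ((n : ℝ) + 2) ≤ 1 / 2 :=
      one_div_le_one_div_of_le two_pos (by linarith [(n.cast_nonneg : (0 : ℝ) ≤ n)])
    simp only [ρ]; linarith
  have hρ0 : ∀ n, 0 < ρ n := fun n => lt_of_lt_of_le (by norm_num) (hρh n)
  have hρ1 : ∀ n, ρ n < 1 := fun n => by
    have : (0 : ℝ) < 1 / ((n : ℝ) + 2) := by positivity
    simp only [ρ]; linarith
  have hinv : Tendsto (fun n : ℕ => 1 / ((n : ℝ) + 2)) atTop (𝓝 0) :=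
    tendsto_const_nhds.div_atTop
      (tendsto_atTop_add_const_right _ _ tendsto_natCast_atTop_atTop)
  have hρlim : Tendsto ρ atTop (𝓝 1) := by simpa [ρ] using hinv.const_sub 1
  have hi : ∀ n, Integrable (jfun p h (ρ n • y)) F := fun n =>
    integrable_jfun hp hε (sub_pos.2 (hρ1 n)) hh hw hk
      (hy.mono fun z hz => le_one_add_dotp_smul (hρ0 n).le hz)
  set D : EuclideanSpace ℝ (Fin d) → ℝ := fun z => 2 * jfun p h ((2⁻¹ : ℝ) • y) z with hDdef
  have hD : Integrable D F :=
    (integrable_jfun hp hε (by norm_num : (0 : ℝ) < 1 - 2⁻¹) hh hw hk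
      (hy.mono fun z hz => le_one_add_dotp_smul (by norm_num) hz)).const_mul 2
  have hJD : ∀ n, ∀ᵐ z ∂F, jfun p h (ρ n • y) z / ρ n ≤ D z := by
    intro n
    filter_upwards [hy] with z hz
    have h1 : 0 < 1 + dotp (ρ n • y) z :=
      (sub_pos.2 (hρ1 n)).trans_le (le_one_add_dotp_smul (hρ0 n).le hz)
    have h2 := mul_jfun_le hp h (l := 2⁻¹ / ρ n) (div_nonneg (by norm_num) (hρ0 n).le)
      ((div_le_one (hρ0 n)).2 (hρh n)) h1.le (Or.inl h1)
    rw [smul_smul, div_mul_cancel₀ _ (hρ0 n).ne'] at h2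
    simp only [hDdef]
    have h3 : jfun p h (ρ n • y) z / ρ n = 2 * (2⁻¹ / ρ n * jfun p h (ρ n • y) z) := by ring
    rw [h3]
    linarith
  set q := (p - 1) / 2 * quadf c y with hq
  have hJv : ∀ n, v - dotp y b - ρ n * q ≤ ∫ z, jfun p h (ρ n • y) z / ρ n ∂F := by
    intro n
    have := hv (ρ n) (hρ0 n) (hρ1 n)
    simp only [greal, quadf_smul, dotp_smul_left] at this
    rw [integral_div, le_div_iff₀ (hρ0 n)]
    simp only [hq]
    linarith
  set A := ∫ z, D z ∂F - v + dotp y b + q with hA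
  have hAlim : Tendsto (fun n => ∫ z, D z ∂F - v + dotp y b + ρ n * q) atTop (𝓝 A) := by
    simpa [hA] using (hρlim.mul_const q).const_add (∫ z, D z ∂F - v + dotp y b)
  have hN : ∀ n, Integrable (fun z => D z - jfun p h (ρ n • y) z / ρ n) F := fun n =>
    hD.sub ((hi n).div_const _)
  have hNle : ∀ n, ∫ z, (D z - jfun p h (ρ n • y) z / ρ n) ∂F
      ≤ ∫ z, D z ∂F - v + dotp y b + ρ n * q := by
    intro n
    rw [integral_sub hD ((hi n).div_const _)]
    linarith [hJv n]
  have hN0 : ∀ n, ∀ᵐ z ∂F, 0 ≤ D z - jfun p h (ρ n • y) z / ρ n := fun n =>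
    (hJD n).mono fun z hz => sub_nonneg.2 hz
  have hA0 : 0 ≤ A := ge_of_tendsto' hAlim fun n =>
    (integral_nonneg_of_ae (hN0 n)).trans (hNle n)
  have hfatou : ∫⁻ z, liminf (fun n => ENNReal.ofReal (D z - jfun p h (ρ n • y) z / ρ n)) atTop ∂F
      ≤ ENNReal.ofReal A := by
    refine (lintegral_liminf_le' fun n => (hN n).aemeasurable.ennreal_ofReal).trans ?_
    rw [← ((ENNReal.continuous_ofReal.tendsto A).comp hAlim).liminf_eq]
    refine liminf_le_liminf (Eventually.of_forall fun n => ?_)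
    rw [← ofReal_integral_eq_lintegral_ofReal (hN n) (hN0 n)]
    exact ENNReal.ofReal_le_ofReal (hNle n)
  have hfin : ∀ᵐ z ∂F,
      liminf (fun n => ENNReal.ofReal (D z - jfun p h (ρ n • y) z / ρ n)) atTop < ⊤ :=
    ae_lt_top (Measurable.liminf fun n => (((measurable_jfun p hh.measurable _).const_mul 2).sub
      ((measurable_jfun p hh.measurable _).div_const _)).ennreal_ofReal)
      (ne_top_of_le_ne_top ENNReal.ofReal_ne_top hfatou)
  have hpos : ∀ᵐ z ∂F, 0 < 1 + dotp y z ∨ 0 < p := by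
    filter_upwards [hy, hfin] with z hz hzfin
    by_contra! hcon
    have ht : dotp y z = -1 := by linarith [hcon.1]
    refine hzfin.ne (Tendsto.liminf_eq (ENNReal.tendsto_ofReal_atTop.comp ?_))
    have h1 : Tendsto (fun n => util p (1 + dotp (ρ n • y) z)) atTop atBot := by
      refine (tendsto_util_zero hcon.2).comp (tendsto_nhdsWithin_iff.2 ⟨?_, ?_⟩)
      · simpa [dotp_smul_left, ht, ρ] using hinv
      · refine Eventually.of_forall fun n => ?_
        rw [dotp_smul_left, ht, mem_Ioi]
        linarith [hρ1 n]
    have h2 : Tendsto (fun n => jfun p h (ρ n • y) z) atTop atBot := by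
      have h3 : Tendsto (fun n => -dotp (ρ n • y) (h z)) atTop (𝓝 (-(1 * dotp y (h z)))) := by
        simp only [dotp_smul_left]
        exact (hρlim.mul_const _).neg
      simpa [jfun, sub_eq_add_neg] using h1.atBot_add h3
    have h4 : Tendsto (fun n => (ρ n)⁻¹) atTop (𝓝 1) := by
      simpa using hρlim.inv₀ one_ne_zero
    have h5 := h2.atBot_mul_pos one_pos h4
    simpa [sub_eq_add_neg, div_eq_mul_inv] using
      tendsto_atTop_add_const_left atTop (D z) (tendsto_neg_atBot_atTop.comp h5)
  have hIj : ∀ᵐ z ∂F, Ifun p h y z = (jfun p h y z : EReal) := by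
    filter_upwards [hpos] with z hz using Ifun_of_pos h hz
  have hlim : ∀ᵐ z ∂F, Tendsto (fun n => D z - jfun p h (ρ n • y) z / ρ n) atTop
      (𝓝 (D z - jfun p h y z)) := by
    filter_upwards [hpos] with z hz
    refine Tendsto.const_sub _ ?_
    have h1 : Tendsto (fun n => dotp (ρ n • y) z) atTop (𝓝 (dotp y z)) := by
      simpa [dotp_smul_left] using hρlim.mul_const (dotp y z)
    have h2 : Tendsto (fun n => dotp (ρ n • y) (h z)) atTop (𝓝 (dotp y (h z))) := by
      simpa [dotp_smul_left] using hρlim.mul_const (dotp y (h z))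
    have h3 := ((continuousAt_util hz).tendsto.comp (h1.const_add 1)).sub h2
    have h4 : Tendsto (fun n => jfun p h (ρ n • y) z / ρ n) atTop (𝓝 (jfun p h y z / 1)) :=
      h3.div hρlim one_ne_zero
    simpa using h4
  have hDj0 : ∀ᵐ z ∂F, 0 ≤ D z - jfun p h y z := by
    filter_upwards [hlim, ae_all_iff.2 hN0] with z h1 h2 using ge_of_tendsto' h1 h2
  have hjm := measurable_jfun p hh.measurable y
  have hle : ∫⁻ z, ENNReal.ofReal (D z - jfun p h y z) ∂F ≤ ENNReal.ofReal A := by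
    refine le_of_eq_of_le (lintegral_congr_ae ?_) hfatou
    filter_upwards [hlim] with z hz
    exact ((ENNReal.continuous_ofReal.tendsto _).comp hz).liminf_eq.symm
  have hDj : Integrable (fun z => D z - jfun p h y z) F := by
    refine ⟨hD.aestronglyMeasurable.sub hjm.aestronglyMeasurable, ?_⟩
    rw [hasFiniteIntegral_iff_ofReal hDj0]
    exact hle.trans_lt ENNReal.ofReal_lt_top
  have hj : Integrable (jfun p h y) F := by
    refine (hD.sub hDj).congr (Eventually.of_forall fun z => ?_)
    simp
  rw [gTheta_eq_greal hIj hj, EReal.coe_le_coe_iff]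
  rw [← ofReal_integral_eq_lintegral_ofReal hDj hDj0, ENNReal.ofReal_le_ofReal_iff hA0,
    integral_sub hD hj] at hle
  simp only [greal]
  linarith

/-- Bounded continuous approximations from below of `J / sqw + C`. -/
def truncDensity {d : ℕ} (J : EuclideanSpace ℝ (Fin d) → ℝ) (C : ℝ) (n : ℕ)
    (z : EuclideanSpace ℝ (Fin d)) : ℝ :=
  min (max (J z / sqw z + C) 0) n * min 1 (n * ‖z‖)

theorem truncDensity_nonneg {d : ℕ} (J : EuclideanSpace ℝ (Fin d) → ℝ) (C : ℝ) (n : ℕ)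
    (z : EuclideanSpace ℝ (Fin d)) : 0 ≤ truncDensity J C n z :=
  mul_nonneg (le_min (le_max_right _ _) n.cast_nonneg) (le_min zero_le_one (by positivity))

theorem truncDensity_le {d : ℕ} (J : EuclideanSpace ℝ (Fin d) → ℝ) (C : ℝ) (n : ℕ)
    (z : EuclideanSpace ℝ (Fin d)) : truncDensity J C n z ≤ n :=
  (mul_le_of_le_one_right (le_min (le_max_right _ _) n.cast_nonneg) (min_le_left _ _)).trans
    (min_le_right _ _)

theorem sqw_pos {d : ℕ} {z : EuclideanSpace ℝ (Fin d)} (hz : z ≠ 0) : 0 < sqw z :=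
  lt_min (pow_pos (norm_pos_iff.2 hz) 2) one_pos

theorem sqw_zero {d : ℕ} : sqw (0 : EuclideanSpace ℝ (Fin d)) = 0 := by
  simp [sqw]

theorem continuous_truncDensity {d : ℕ} {J : EuclideanSpace ℝ (Fin d) → ℝ} (hJ : Continuous J)
    (C : ℝ) (n : ℕ) : Continuous (truncDensity J C n) := by
  rw [continuous_iff_continuousAt]
  intro z
  by_cases hz : z = 0
  · subst hz
    have h0 : truncDensity J C n 0 = 0 := by simp [truncDensity]
    rw [ContinuousAt, h0]
    refine squeeze_zero (truncDensity_nonneg J C n)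
      (g := fun z => (n : ℝ) * (n * ‖z‖)) (fun z => ?_) ?_
    · exact mul_le_mul (min_le_right _ _) (min_le_right _ _) (le_min zero_le_one (by positivity))
        n.cast_nonneg
    · have : Continuous fun z : EuclideanSpace ℝ (Fin d) => (n : ℝ) * (n * ‖z‖) := by fun_prop
      simpa using this.tendsto 0
  · have h1 : ContinuousAt (fun z => J z / sqw z) z :=
      hJ.continuousAt.div continuous_sqw.continuousAt (sqw_pos hz).ne'
    have h2 : Continuous fun z : EuclideanSpace ℝ (Fin d) => min 1 ((n : ℝ) * ‖z‖) := by fun_prop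
    exact (((h1.add continuousAt_const).max continuousAt_const).min continuousAt_const).mul
      h2.continuousAt

theorem sqw_mul_truncDensity_le {d : ℕ} {J : EuclideanSpace ℝ (Fin d) → ℝ} {C : ℝ} (n : ℕ)
    {z : EuclideanSpace ℝ (Fin d)} (hJ0 : J 0 = 0) (hz : -(C * sqw z) ≤ J z) :
    sqw z * truncDensity J C n z ≤ J z + C * sqw z := by
  by_cases h0 : z = 0
  · subst h0; simp [sqw_zero, hJ0]
  have hw := sqw_pos h0
  have h1 : 0 ≤ J z / sqw z + C := by
    have : J z / sqw z + C = (J z + C * sqw z) / sqw z := by field_simp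
    rw [this]
    exact div_nonneg (by linarith) hw.le
  have h2 : truncDensity J C n z ≤ J z / sqw z + C := by
    rw [truncDensity, max_eq_left h1]
    exact (mul_le_of_le_one_right (le_min h1 n.cast_nonneg) (min_le_left _ _)).trans
      (min_le_left _ _)
  calc sqw z * truncDensity J C n z ≤ sqw z * (J z / sqw z + C) :=
        mul_le_mul_of_nonneg_left h2 hw.le
    _ = J z + C * sqw z := by field_simp

theorem tendsto_sqw_mul_truncDensity {d : ℕ} {J : EuclideanSpace ℝ (Fin d) → ℝ} {C : ℝ}
    {z : EuclideanSpace ℝ (Fin d)} (hJ0 : J 0 = 0) (hz : -(C * sqw z) ≤ J z) :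
    Tendsto (fun n => sqw z * truncDensity J C n z) atTop (𝓝 (J z + C * sqw z)) := by
  by_cases h0 : z = 0
  · subst h0; simp [sqw_zero, hJ0]
  have hw := sqw_pos h0
  have h1 : 0 ≤ J z / sqw z + C := by
    have : J z / sqw z + C = (J z + C * sqw z) / sqw z := by field_simp
    rw [this]
    exact div_nonneg (by linarith) hw.le
  refine tendsto_const_nhds.congr' ?_
  have hz0 : 0 < ‖z‖ := norm_pos_iff.2 h0
  filter_upwards [tendsto_natCast_atTop_atTop.eventually_ge_atTop (J z / sqw z + C),
    tendsto_natCast_atTop_atTop.eventually_ge_atTop (1 / ‖z‖)] with n hn1 hn2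
  rw [truncDensity, max_eq_left h1, min_eq_left hn1, min_eq_left ((div_le_iff₀ hz0).1 hn2)]
  field_simp

theorem integral_sq1Measure {d : ℕ} (F : Measure (EuclideanSpace ℝ (Fin d)))
    (f : EuclideanSpace ℝ (Fin d) → ℝ) :
    ∫ z, f z ∂(sq1Measure F) = ∫ z, sqw z * f z ∂F := by
  rw [sq1Measure, integral_withDensity_eq_integral_toReal_smul
    (by exact continuous_sqw.measurable.ennreal_ofReal)
    (Eventually.of_forall fun _ => ENNReal.ofReal_lt_top)]
  refine integral_congr_ae (Eventually.of_forall fun z => ?_)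
  change (ENNReal.ofReal (sqw z)).toReal • f z = _
  rw [ENNReal.toReal_ofReal (sqw_nonneg z), smul_eq_mul]

/-- Lower semicontinuity of `F ↦ ∫ J dF` along weak convergence of `sq1Measure F`. -/
theorem add_integral_le_of_tendsto_sq1Measure {d : ℕ} {J : EuclideanSpace ℝ (Fin d) → ℝ}
    (hJ : Continuous J) (hJ0 : J 0 = 0) {C : ℝ} {Fs : ℕ → Measure (EuclideanSpace ℝ (Fin d))}
    {F : Measure (EuclideanSpace ℝ (Fin d))}
    (hweak : ∀ f : EuclideanSpace ℝ (Fin d) → ℝ, Continuous f → (∃ M : ℝ, ∀ x, |f x| ≤ M) →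
      Tendsto (fun k => ∫ z, f z ∂(sq1Measure (Fs k))) atTop (𝓝 (∫ z, f z ∂(sq1Measure F))))
    (hws : ∀ k, Integrable sqw (Fs k)) (hw : Integrable sqw F)
    (hJs : ∀ k, Integrable J (Fs k)) (hJi : Integrable J F)
    (hbs : ∀ k, ∀ᵐ z ∂(Fs k), -(C * sqw z) ≤ J z) (hb : ∀ᵐ z ∂F, -(C * sqw z) ≤ J z)
    {Ls : ℕ → ℝ} {L a : ℝ} (hL : Tendsto Ls atTop (𝓝 L))
    (ha : ∀ᶠ k in atTop, Ls k + ∫ z, J z ∂(Fs k) ≤ a) : L + ∫ z, J z ∂F ≤ a := by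
  have hQi : ∀ (n : ℕ) (G : Measure (EuclideanSpace ℝ (Fin d))), Integrable sqw G →
      Integrable (fun z => sqw z * truncDensity J C n z) G := by
    intro n G hG
    refine (hG.const_mul (n : ℝ)).mono'
      (continuous_sqw.mul (continuous_truncDensity hJ C n)).aestronglyMeasurable
      (Eventually.of_forall fun z => ?_)
    rw [Real.norm_of_nonneg (mul_nonneg (sqw_nonneg z) (truncDensity_nonneg J C n z)), mul_comm]
    exact mul_le_mul_of_nonneg_right (truncDensity_le J C n z) (sqw_nonneg z)
  have hone : Tendsto (fun k => ∫ z, sqw z ∂(Fs k)) atTop (𝓝 (∫ z, sqw z ∂F)) := by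
    have := hweak (fun _ => 1) continuous_const ⟨1, fun _ => by simp⟩
    simpa only [integral_sq1Measure, mul_one] using this
  have hn : ∀ n : ℕ, L + (∫ z, sqw z * truncDensity J C n z ∂F - C * ∫ z, sqw z ∂F) ≤ a := by
    intro n
    have h1 := hweak (truncDensity J C n) (continuous_truncDensity hJ C n) ⟨n, fun z => by
      rw [abs_of_nonneg (truncDensity_nonneg J C n z)]; exact truncDensity_le J C n z⟩
    simp only [integral_sq1Measure] at h1
    refine le_of_tendsto (hL.add (h1.sub (hone.const_mul C))) ?_
    filter_upwards [ha] with k hk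
    have h2 : ∫ z, sqw z * truncDensity J C n z ∂(Fs k)
        ≤ ∫ z, J z ∂(Fs k) + C * ∫ z, sqw z ∂(Fs k) := by
      rw [← integral_const_mul, ← integral_add (hJs k) ((hws k).const_mul C)]
      refine integral_mono_ae (hQi n _ (hws k)) ((hJs k).add ((hws k).const_mul C)) ?_
      filter_upwards [hbs k] with z hz
      exact sqw_mul_truncDensity_le n hJ0 hz
    linarith
  have hlim : Tendsto (fun n : ℕ => ∫ z, sqw z * truncDensity J C n z ∂F) atTop
      (𝓝 (∫ z, (J z + C * sqw z) ∂F)) := by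
    refine tendsto_integral_of_dominated_convergence (fun z => J z + C * sqw z)
      (fun n => (hQi n F hw).aestronglyMeasurable) (hJi.add (hw.const_mul C)) (fun n => ?_) ?_
    · filter_upwards [hb] with z hz
      rw [Real.norm_of_nonneg (mul_nonneg (sqw_nonneg z) (truncDensity_nonneg J C n z))]
      exact sqw_mul_truncDensity_le n hJ0 hz
    · filter_upwards [hb] with z hz
      exact tendsto_sqw_mul_truncDensity hJ0 hz
  rw [integral_add hJi (hw.const_mul C), integral_const_mul] at hlim
  have := le_of_tendsto ((hlim.sub_const (C * ∫ z, sqw z ∂F)).const_add L)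
    (Eventually.of_forall hn)
  simpa using this

theorem greal_le_of_tendsto {d : ℕ} {p ε η a : ℝ} (hp : p < 1) (hε : 0 < ε) (hη : 0 < η)
    (hη1 : η ≤ 1) {h : EuclideanSpace ℝ (Fin d) → EuclideanSpace ℝ (Fin d)}
    (hh : IsTruncation h) (hcont : Continuous h) {θs : ℕ → Triple d} {θ : Triple d}
    (hb : Tendsto (fun k => (θs k).1) atTop (𝓝 θ.1))
    (hc : Tendsto (fun k => (θs k).2.1) atTop (𝓝 θ.2.1))
    (hweak : ∀ f : EuclideanSpace ℝ (Fin d) → ℝ, Continuous f → (∃ M : ℝ, ∀ x, |f x| ≤ M) →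
      Tendsto (fun k => ∫ z, f z ∂(sq1Measure (θs k).2.2)) atTop
        (𝓝 (∫ z, f z ∂(sq1Measure θ.2.2))))
    (hws : ∀ k, Integrable sqw (θs k).2.2) (hw : Integrable sqw θ.2.2)
    (hks : ∀ k, Integrable (Kintegrand p ε) (θs k).2.2) (hk : Integrable (Kintegrand p ε) θ.2.2)
    {y : EuclideanSpace ℝ (Fin d)} (hys : ∀ k, ∀ᵐ z ∂(θs k).2.2, η ≤ 1 + dotp y z)
    (hy : ∀ᵐ z ∂θ.2.2, η ≤ 1 + dotp y z)
    (ha : ∀ᶠ k in atTop, greal p h (θs k) y ≤ a) : greal p h θ y ≤ a := by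
  obtain ⟨C, hC⟩ := jfun_bounds (p := p) hp hε hη (norm_nonneg y) hh
  have hdot : Continuous (dotp y) := continuous_dotp.comp (Continuous.prodMk_right y)
  set J : EuclideanSpace ℝ (Fin d) → ℝ :=
    fun z => util p (max (1 + dotp y z) η) - dotp y (h z) with hJdef
  have hJ : Continuous J := by
    refine Continuous.sub ?_ (hdot.comp hcont)
    refine continuous_iff_continuousAt.2 fun z => ?_
    exact ContinuousAt.comp (f := fun z => max (1 + dotp y z) η)
      (hasDerivAt_util p (hη.trans_le (le_max_right _ _))).continuousAt
      ((continuous_const.add hdot).max continuous_const).continuousAt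
  have hJ0 : J 0 = 0 := by
    obtain ⟨δ, hδ, hid⟩ := hh.eq_id_near_zero
    have h0 : h 0 = 0 := hid 0 (by simpa using hδ)
    have h1 : dotp y 0 = 0 := by rw [dotp_eq_inner, inner_zero_right]
    simp only [hJdef, h0, h1, add_zero, max_eq_left hη1, util_one, sub_zero]
  have hJeq : ∀ z, η ≤ 1 + dotp y z → jfun p h y z = J z := fun z hz => by
    simp only [hJdef, max_eq_left hz, jfun]
  have hae : ∀ {F : Measure (EuclideanSpace ℝ (Fin d))}, (∀ᵐ z ∂F, η ≤ 1 + dotp y z) →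
      jfun p h y =ᵐ[F] J := fun hF => by
    filter_upwards [hF] with z hz using hJeq z hz
  have hlow : ∀ {F : Measure (EuclideanSpace ℝ (Fin d))}, (∀ᵐ z ∂F, η ≤ 1 + dotp y z) →
      ∀ᵐ z ∂F, -(C * sqw z) ≤ J z := fun hF => by
    filter_upwards [hF] with z hz
    rw [← hJeq z hz]
    exact (hC y z le_rfl hz).1
  have hq : Continuous fun c : Matrix (Fin d) (Fin d) ℝ => quadf c y := by
    unfold quadf; fun_prop
  have hL : Tendsto (fun k => dotp y (θs k).1 + (p - 1) / 2 * quadf (θs k).2.1 y) atTop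
      (𝓝 (dotp y θ.1 + (p - 1) / 2 * quadf θ.2.1 y)) :=
    ((hdot.tendsto _).comp hb).add (((hq.tendsto _).comp hc).const_mul _)
  have hint := fun k => integrable_jfun hp hε hη hh (hws k) (hks k) (hys k)
  have hint0 := integrable_jfun hp hε hη hh hw hk hy
  rw [greal, integral_congr_ae (hae hy)]
  refine add_integral_le_of_tendsto_sq1Measure hJ hJ0 hweak hws hw
    (fun k => (hint k).congr (hae (hys k))) (hint0.congr (hae hy))
    (fun k => hlow (hys k)) (hlow hy) hL ?_
  filter_upwards [ha] with k hk'
  rwa [greal, integral_congr_ae (hae (hys k))] at hk'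

theorem Standing.p_lt_one {d : ℕ} {p ε : ℝ}
    {h : EuclideanSpace ℝ (Fin d) → EuclideanSpace ℝ (Fin d)}
    {Θ : Set (Triple d)} {C : Set (EuclideanSpace ℝ (Fin d))} (SA : Standing p ε h Θ C) :
    p < 1 := by
  rcases SA.p_range with h | h | h <;> linarith

theorem Standing.integrable_sqw {d : ℕ} {p ε : ℝ}
    {h : EuclideanSpace ℝ (Fin d) → EuclideanSpace ℝ (Fin d)}
    {Θ : Set (Triple d)} {C : Set (EuclideanSpace ℝ (Fin d))} (SA : Standing p ε h Θ C)
    {θ : Triple d} (hθ : θ ∈ Θ) : Integrable sqw θ.2.2 :=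
  (lintegral_ofReal_ne_top_iff_integrable continuous_sqw.aestronglyMeasurable
    (Eventually.of_forall sqw_nonneg)).1 (SA.Theta_levy θ hθ).2.ne

theorem Standing.integrable_kintegrand {d : ℕ} {p ε : ℝ}
    {h : EuclideanSpace ℝ (Fin d) → EuclideanSpace ℝ (Fin d)}
    {Θ : Set (Triple d)} {C : Set (EuclideanSpace ℝ (Fin d))} (SA : Standing p ε h Θ C)
    {θ : Triple d} (hθ : θ ∈ Θ) : Integrable (Kintegrand p ε) θ.2.2 := by
  obtain ⟨K, hK⟩ := SA.K_finite
  exact (lintegral_ofReal_ne_top_iff_integrable (measurable_kintegrand p ε).aestronglyMeasurable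
    (Eventually.of_forall (kintegrand_nonneg p ε))).1 (hK θ hθ).1

theorem ae_of_mem_natC {d : ℕ} {Θ : Set (Triple d)} {y : EuclideanSpace ℝ (Fin d)}
    (hy : y ∈ natC Θ) {θ : Triple d} (hθ : θ ∈ Θ) : ∀ᵐ z ∂θ.2.2, 0 ≤ 1 + dotp y z := by
  have h1 := hy θ hθ
  rw [ae_iff]
  convert h1 using 3
  ext z
  simp only [not_le]
  constructor <;> intro h <;> linarith

theorem mem_natC_of_ae {d : ℕ} {Θ : Set (Triple d)} {y : EuclideanSpace ℝ (Fin d)}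
    (hy : ∀ θ ∈ Θ, ∀ᵐ z ∂θ.2.2, 0 ≤ 1 + dotp y z) : y ∈ natC Θ := by
  intro θ hθ
  have h1 := hy θ hθ
  rw [ae_iff] at h1
  convert h1 using 3
  ext z
  simp only [not_le]
  constructor <;> intro h <;> linarith

theorem zero_mem_natC {d : ℕ} (Θ : Set (Triple d)) : 0 ∈ natC Θ :=
  mem_natC_of_ae fun _ _ => Eventually.of_forall fun z => by
    rw [dotp_eq_inner, inner_zero_left]; norm_num

theorem convex_natC {d : ℕ} (Θ : Set (Triple d)) : Convex ℝ (natC Θ) := by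
  intro x hx y hy a b ha hb hab
  refine mem_natC_of_ae fun θ hθ => ?_
  filter_upwards [ae_of_mem_natC hx hθ, ae_of_mem_natC hy hθ] with z h1 h2
  rw [dotp_add_left, dotp_smul_left, dotp_smul_left]
  nlinarith [mul_nonneg ha h1, mul_nonneg hb h2]

theorem ae_of_smul_mem_natC {d : ℕ} {Θ : Set (Triple d)} {y : EuclideanSpace ℝ (Fin d)}
    (hy : y ∈ natC Θ) {θ : Triple d} (hθ : θ ∈ Θ) {r : ℝ} (hr : 0 ≤ r) :
    ∀ᵐ z ∂θ.2.2, 1 - r ≤ 1 + dotp (r • y) z := by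
  filter_upwards [ae_of_mem_natC hy hθ] with z hz
  exact le_one_add_dotp_smul hr hz

theorem greal_zero {d : ℕ} (p : ℝ) (h : EuclideanSpace ℝ (Fin d) → EuclideanSpace ℝ (Fin d))
    (θ : Triple d) : greal p h θ 0 = 0 := by
  simp [greal, jfun, quadf, dotp_eq_inner, util_one]

/-- Under the standing assumptions, with `h` continuous and `Θ`
sequentially compact (every sequence in `Θ` has a subsequence whose drifts and volatility
matrices converge and whose measures `|z|²∧1·Fₖ` converge weakly, with limit in `Θ`), the
function `(θ, y) ↦ g^θ(y)` admits a saddle point on `Θ × (C ∩ C⁰)`. -/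
theorem stmt11 {d : ℕ} (hd : 1 ≤ d) (p ε : ℝ)
    (h : EuclideanSpace ℝ (Fin d) → EuclideanSpace ℝ (Fin d)) (hcont : Continuous h)
    (Θ : Set (Triple d)) (C : Set (EuclideanSpace ℝ (Fin d)))
    (SA : Standing p ε h Θ C)
    (hcomp : ∀ θseq : ℕ → Triple d, (∀ k, θseq k ∈ Θ) →
      ∃ θ ∈ Θ, ∃ φ : ℕ → ℕ, StrictMono φ ∧
        Tendsto (fun k => (θseq (φ k)).1) atTop (nhds θ.1) ∧
        Tendsto (fun k => (θseq (φ k)).2.1) atTop (nhds θ.2.1) ∧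
        ∀ f : EuclideanSpace ℝ (Fin d) → ℝ, Continuous f → (∃ M : ℝ, ∀ x, |f x| ≤ M) →
          Tendsto (fun k => ∫ z, f z ∂(sq1Measure (θseq (φ k)).2.2)) atTop
            (nhds (∫ z, f z ∂(sq1Measure θ.2.2)))) :
    ∃ θhat ∈ Θ, ∃ yhat ∈ C ∩ natC Θ,
      (∀ y ∈ C ∩ natC Θ, gTheta p h θhat y ≤ gTheta p h θhat yhat) ∧
      (∀ θ ∈ Θ, gTheta p h θhat yhat ≤ gTheta p h θ yhat) := by
  have hp := SA.p_lt_one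
  have hε := SA.eps_pos
  have hh := SA.trunc
  have hKc : Convex ℝ (C ∩ natC Θ) := SA.C_convex.inter (convex_natC Θ)
  have h0 : (0 : EuclideanSpace ℝ (Fin d)) ∈ C ∩ natC Θ := ⟨SA.C_zero, zero_mem_natC Θ⟩
  have hint : ∀ θ ∈ Θ, ∀ y ∈ innerPart (C ∩ natC Θ), Integrable (jfun p h y) θ.2.2 := by
    rintro θ hθ _ ⟨r, hr0, hr1, x, hx, rfl⟩
    exact integrable_jfun hp hε (sub_pos.2 hr1) hh (SA.integrable_sqw hθ)
      (SA.integrable_kintegrand hθ) (ae_of_smul_mem_natC hx.2 hθ hr0.le)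
  obtain ⟨v, θhat, hθhat, yhat, hyhat, hle, hge⟩ :=
    exists_minimax_value (G := greal p h) SA.Theta_nonempty SA.CC0_compact hKc h0
      (fun θ hθ r hr0 hr1 => continuousOn_greal_smul hp hε hh (SA.integrable_sqw hθ)
        (SA.integrable_kintegrand hθ) SA.CC0_compact.isBounded
        (fun y hy => ae_of_mem_natC hy.2 hθ) hr0 hr1)
      (fun θ hθ => ⟨convex_innerPart hKc h0, by
        rintro _ ⟨r, hr0, hr1, x, hx, rfl⟩ _ ⟨s, hs0, hs1, y, hy, rfl⟩ a b ha hb hab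
        refine greal_concave hp hε (η := min (1 - r) (1 - s))
          (lt_min (sub_pos.2 hr1) (sub_pos.2 hs1)) hh (SA.Theta_psd θ hθ) (SA.integrable_sqw hθ)
          (SA.integrable_kintegrand hθ) ?_ ?_ ha hb hab
        · filter_upwards [ae_of_smul_mem_natC hx.2 hθ hr0.le] with z hz
          exact (min_le_left _ _).trans hz
        · filter_upwards [ae_of_smul_mem_natC hy.2 hθ hs0.le] with z hz
          exact (min_le_right _ _).trans hz⟩)
      (fun θ _ => greal_zero p h θ)
      (fun θ₁ h₁ θ₂ h₂ t ht0 ht1 => ⟨_, SA.Theta_convex θ₁ h₁ θ₂ h₂ t ht0 ht1, fun y hy =>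
        (greal_mix (hint θ₁ h₁ y hy) (hint θ₂ h₂ y hy) ht0 ht1).le⟩)
      (fun θs hθs => by
        obtain ⟨θ, hθ, φ, hφ, hb, hc, hweak⟩ := hcomp θs hθs
        refine ⟨θ, hθ, φ, hφ, ?_⟩
        rintro _ ⟨r, hr0, hr1, x, hx, rfl⟩ a ha
        exact greal_le_of_tendsto hp hε (sub_pos.2 hr1) (by linarith) hh hcont
          (θs := fun k => θs (φ k)) hb hc hweak
          (fun k => SA.integrable_sqw (hθs _)) (SA.integrable_sqw hθ)
          (fun k => SA.integrable_kintegrand (hθs _)) (SA.integrable_kintegrand hθ)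
          (fun k => ae_of_smul_mem_natC hx.2 (hθs _) hr0.le)
          (ae_of_smul_mem_natC hx.2 hθ hr0.le) ha)
  have hupper : ∀ y ∈ C ∩ natC Θ, gTheta p h θhat y ≤ (v : EReal) := by
    intro y hy
    have hlim : Tendsto (fun r : ℝ => ((v / r : ℝ) : EReal)) (𝓝[<] 1) (𝓝 (v : EReal)) := by
      refine (continuous_coe_real_ereal.tendsto v).comp ?_
      have : ContinuousAt (fun r : ℝ => v / r) 1 := by fun_prop (disch := norm_num)
      simpa using this.tendsto.mono_left (nhdsWithin_le_nhds (s := Iio 1))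
    refine ge_of_tendsto hlim ?_
    filter_upwards [Ioo_mem_nhdsLT (zero_lt_one' ℝ)] with r ⟨hr0, hr1⟩
    refine (gTheta_le hp hε hh (SA.Theta_psd _ hθhat) (SA.integrable_sqw hθhat)
      (SA.integrable_kintegrand hθhat) (ae_of_mem_natC hy.2 hθhat) hr0 hr1).trans ?_
    exact EReal.coe_le_coe_iff.2
      (div_le_div_of_nonneg_right (hle _ ⟨r, hr0, hr1, y, hy, rfl⟩) hr0.le)
  have hlower : ∀ θ ∈ Θ, (v : EReal) ≤ gTheta p h θ yhat := fun θ hθ =>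
    le_gTheta hp hε hh (SA.integrable_sqw hθ) (SA.integrable_kintegrand hθ)
      (ae_of_mem_natC hyhat.2 hθ) (hge θ hθ)
  exact ⟨θhat, hθhat, yhat, hyhat, fun y hy => (hupper y hy).trans (hlower θhat hθhat),
    fun θ hθ => (hupper yhat hyhat).trans (hlower θ hθ)⟩
end
end

section
/- Let 0 < b_min ≤ b_max, 0 < c_min ≤ c_max, 0 < λ_min ≤ λ_max be real numbers with b_min − c_max − λ_max > 0. For b, c, λ > 0 define f_{b,c,λ} : (−1,∞) → ℝ by f_{b,c,λ}(y) = y·b − (c/2)·y² + λ·(log(1+y) − y), and set ŷ := [ (b_min−c_max−λ_max) + √((b_min−c_max−λ_max)² + 4·b_min·c_max) ] / (2·c_max). Then ((b_min, c_max, λ_max), ŷ) is a saddle point: for all b ∈ [b_min,b_max], c ∈ [c_min,c_max], λ ∈ [λ_min,λ_max] and all y ∈ (−1,∞), one has f_{b,c,λ}(ŷ) ≥ f_{b_min,c_max,λ_max}(ŷ) ≥ f_{b_min,c_max,λ_max}(y). -/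
open Set

noncomputable section

/-- The positive root of `c * y ^ 2 - a * y - b`. -/
lemma pos_root_of_quadratic (a b c : ℝ) (ha : 0 < a) (hb : 0 < b) (hc : 0 < c) :
    0 < (a + √(a ^ 2 + 4 * b * c)) / (2 * c) ∧
      c * ((a + √(a ^ 2 + 4 * b * c)) / (2 * c)) ^ 2 =
        a * ((a + √(a ^ 2 + 4 * b * c)) / (2 * c)) + b := by
  have hs : √(a ^ 2 + 4 * b * c) ^ 2 = a ^ 2 + 4 * b * c := Real.sq_sqrt (by positivity)
  refine ⟨by positivity, ?_⟩
  generalize √(a ^ 2 + 4 * b * c) = s at hs ⊢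
  field_simp
  linear_combination hs

/-- The tangent line of `log (1 + ·)` at `x` lies above its graph. -/
lemma log_one_add_le_tangent {x y : ℝ} (hx : -1 < x) (hy : -1 < y) :
    Real.log (1 + y) ≤ Real.log (1 + x) + (y - x) / (1 + x) := by
  have hx' : 0 < 1 + x := by linarith
  have hy' : 0 < 1 + y := by linarith
  have h := Real.log_le_sub_one_of_pos (div_pos hy' hx')
  rw [Real.log_div hy'.ne' hx'.ne'] at h
  have h' : (1 + y) / (1 + x) - 1 = (y - x) / (1 + x) := by
    field_simp
    ring
  linarith

/-- With `0 < b_min ≤ b_max`, `0 < c_min ≤ c_max`, `0 < l_min ≤ l_max` and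
`b_min - c_max - l_max > 0`, and `f_{b,c,l}(y) = y·b - (c/2)·y² + l·(log(1+y) - y)`,
the point `((b_min, c_max, l_max), yhat)` with
`yhat = ((b_min - c_max - l_max) + √((b_min - c_max - l_max)² + 4·b_min·c_max))/(2·c_max)`
is a saddle point: `f_{b,c,l}(yhat) ≥ f_{b_min,c_max,l_max}(yhat) ≥ f_{b_min,c_max,l_max}(y)`
for all parameters in the ranges and all `y ∈ (-1, ∞)`. -/
theorem stmt16 (bmin bmax cmin cmax lmin lmax : ℝ)
    (hb0 : 0 < bmin) (hb : bmin ≤ bmax)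
    (hc0 : 0 < cmin) (hc : cmin ≤ cmax)
    (hl0 : 0 < lmin) (hl : lmin ≤ lmax)
    (hpos : 0 < bmin - cmax - lmax) :
    (∀ b ∈ Icc bmin bmax, ∀ c ∈ Icc cmin cmax, ∀ l ∈ Icc lmin lmax,
      (fun (b c l y : ℝ) => y * b - c / 2 * y ^ 2 + l * (Real.log (1 + y) - y))
          bmin cmax lmax
          (((bmin - cmax - lmax) +
            Real.sqrt ((bmin - cmax - lmax) ^ 2 + 4 * bmin * cmax)) / (2 * cmax)) ≤
        (fun (b c l y : ℝ) => y * b - c / 2 * y ^ 2 + l * (Real.log (1 + y) - y))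
          b c l
          (((bmin - cmax - lmax) +
            Real.sqrt ((bmin - cmax - lmax) ^ 2 + 4 * bmin * cmax)) / (2 * cmax))) ∧
    (∀ y ∈ Ioi (-1 : ℝ),
      (fun (b c l y : ℝ) => y * b - c / 2 * y ^ 2 + l * (Real.log (1 + y) - y))
          bmin cmax lmax y ≤
        (fun (b c l y : ℝ) => y * b - c / 2 * y ^ 2 + l * (Real.log (1 + y) - y))
          bmin cmax lmax
          (((bmin - cmax - lmax) +
            Real.sqrt ((bmin - cmax - lmax) ^ 2 + 4 * bmin * cmax)) / (2 * cmax))) := by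
  have hcm : 0 < cmax := hc0.trans_le hc
  have hlm : 0 < lmax := hl0.trans_le hl
  obtain ⟨hx, hroot⟩ := pos_root_of_quadratic _ bmin cmax hpos hb0 hcm
  generalize ((bmin - cmax - lmax) +
    Real.sqrt ((bmin - cmax - lmax) ^ 2 + 4 * bmin * cmax)) / (2 * cmax) = x at *
  refine ⟨fun b hb c hc l hl => ?_, fun y hy => ?_⟩
  · have hlog : Real.log (1 + x) ≤ x := by
      linarith [Real.log_le_sub_one_of_pos (show 0 < 1 + x by linarith)]
    have hbx := mul_le_mul_of_nonneg_left hb.1 hx.le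
    have hcx := mul_le_mul_of_nonneg_right hc.2 (sq_nonneg x)
    have hlx := mul_le_mul_of_nonpos_right hl.2 (sub_nonpos.2 hlog)
    dsimp only
    linarith
  · have htangent := mul_le_mul_of_nonneg_left
      (log_one_add_le_tangent (show -1 < x by linarith) hy) hlm.le
    have hcrit : lmax * ((y - x) / (1 + x)) = (y - x) * (lmax - bmin + cmax * x) := by
      field_simp
      linear_combination (x - y) * hroot
    have hsq := mul_nonneg hcm.le (sq_nonneg (y - x))
    dsimp only
    linarith
end
end
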